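/- arXiv:2304.02427 — 17 statements merged into one kernel-verified Lean document; each statement's English description precedes it below -/
import Mathlib

section
/- Let n ≥ 3 be odd, 𝕜 a field containing a primitive n-th root of unity ξ, ε ∈ {+1, −1}, and i, m ∈ ℤ_n. Define F : ℤ_n × ℤ_n → 𝕜ˣ by F(ℓ, r) = ε ξ^{2i(m − i − ℓ − r)}, and let f_y(x) = x + 2y and g_x(y) = −y be the component maps of the solution s(ℓ, r) = (−r, ℓ + 2r). Then F satisfies the cocycle condition F(x, y) · F(f_y(x), z) · F(g_x(y), g_{f_y(x)}(z)) = F(y, z) · F(x, g_y(z)) · F(f_{g_y(z)}(x), f_z(y)) for all x, y, z ∈ ℤ_n. -/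
theorem stmt3 (n : ℕ) (hn : 3 ≤ n) (hodd : Odd n)
    {𝕜 : Type*} [Field 𝕜] (ξ : 𝕜) (hξ : IsPrimitiveRoot ξ n)
    (ε : 𝕜) (hε : ε = 1 ∨ ε = -1) (i m : ZMod n)
    (F : ZMod n → ZMod n → 𝕜)
    (hF : ∀ ℓ r : ZMod n, F ℓ r = ε * ξ ^ (2 * i * (m - i - ℓ - r)).val) :
    -- cocycle condition `F(x,y) F(f_y(x),z) F(g_x(y), g_{f_y(x)}(z))
    --   = F(y,z) F(x, g_y(z)) F(f_{g_y(z)}(x), f_z(y))`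
    -- with `f_y(x) = x + 2y` and `g_x(y) = −y`
    ∀ x y z : ZMod n,
      F x y * F (x + 2 * y) z * F (-y) (-z)
        = F y z * F x (-z) * F (x + 2 * (-z)) (y + 2 * z) := by
  intro x y z
  haveI : NeZero n := ⟨by omega⟩
  have key : ∀ a b : ZMod n, ξ ^ a.val * ξ ^ b.val = ξ ^ (a + b).val := by
    intro a b
    rw [← pow_add, ZMod.val_add, pow_eq_pow_mod (a.val + b.val) hξ.pow_eq_one]
  have tri : ∀ a b c : ZMod n, (ε * ξ ^ a.val) * (ε * ξ ^ b.val) * (ε * ξ ^ c.val)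
      = ε ^ 3 * ξ ^ (a + b + c).val := by
    intro a b c
    rw [← key, ← key]
    ring
  simp only [hF]
  rw [tri, tri]
  congr 3
  ring
end

section
/- Let n ≥ 3 be odd, 𝕜 a field containing a primitive n-th root of unity ξ, ε ∈ {+1, −1}, and i, m ∈ ℤ_n. Let V be the free 𝕜-module with basis (w_ℓ)_{ℓ ∈ ℤ_n} and let c : V ⊗ V → V ⊗ V be the 𝕜-linear map determined by c(w_ℓ ⊗ w_r) = ε ξ^{2i(m − i − r − ℓ)} w_{−r} ⊗ w_{ℓ+2r} for all ℓ, r ∈ ℤ_n. Then c is a bijection and satisfies the braid equation (c ⊗ id)∘(id ⊗ c)∘(c ⊗ id) = (id ⊗ c)∘(c ⊗ id)∘(id ⊗ c) on V ⊗ V ⊗ V. -/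
open TensorProduct

/-- `c ⊗ id` as an endomorphism of `V ⊗ (V ⊗ V)`, via the associator. -/
noncomputable def braidL {𝕜 : Type*} [Field 𝕜] {V : Type*} [AddCommGroup V] [Module 𝕜 V]
    (c : V ⊗[𝕜] V →ₗ[𝕜] V ⊗[𝕜] V) : V ⊗[𝕜] (V ⊗[𝕜] V) →ₗ[𝕜] V ⊗[𝕜] (V ⊗[𝕜] V) :=
  (TensorProduct.assoc 𝕜 V V V).toLinearMap ∘ₗ c.rTensor V ∘ₗ
    (TensorProduct.assoc 𝕜 V V V).symm.toLinearMap

/-- `id ⊗ c` as an endomorphism of `V ⊗ (V ⊗ V)`. -/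
noncomputable def braidR {𝕜 : Type*} [Field 𝕜] {V : Type*} [AddCommGroup V] [Module 𝕜 V]
    (c : V ⊗[𝕜] V →ₗ[𝕜] V ⊗[𝕜] V) : V ⊗[𝕜] (V ⊗[𝕜] V) →ₗ[𝕜] V ⊗[𝕜] (V ⊗[𝕜] V) :=
  c.lTensor V

theorem stmt4 (n : ℕ) (hn : 3 ≤ n) (hodd : Odd n)
    {𝕜 : Type*} [Field 𝕜] (ξ : 𝕜) (hξ : IsPrimitiveRoot ξ n)
    (ε : 𝕜) (hε : ε = 1 ∨ ε = -1) (i m : ZMod n)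
    (c : (ZMod n →₀ 𝕜) ⊗[𝕜] (ZMod n →₀ 𝕜) →ₗ[𝕜] (ZMod n →₀ 𝕜) ⊗[𝕜] (ZMod n →₀ 𝕜))
    (hc : ∀ ℓ r : ZMod n,
      c (Finsupp.single ℓ (1 : 𝕜) ⊗ₜ[𝕜] Finsupp.single r (1 : 𝕜))
        = (ε * ξ ^ (2 * i * (m - i - r - ℓ)).val) •
            (Finsupp.single (-r) (1 : 𝕜) ⊗ₜ[𝕜] Finsupp.single (ℓ + 2 * r) (1 : 𝕜))) :
    Function.Bijective c ∧
    braidL c ∘ₗ braidR c ∘ₗ braidL c = braidR c ∘ₗ braidL c ∘ₗ braidR c := by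
  have : NeZero n := ⟨by omega⟩
  have hξ0 : ξ ≠ 0 := hξ.ne_zero (by omega)
  have hε0 : ε ≠ 0 := by rcases hε with h | h <;> simp [h]
  have hadd : ∀ x y : ZMod n, ξ ^ x.val * ξ ^ y.val = ξ ^ (x + y).val := by
    intro x y
    rw [← pow_add, ZMod.val_add]
    exact (pow_mod_orderOf ξ (x.val + y.val)).symm.trans (by rw [← hξ.eq_orderOf, ])
  constructor
  · have hs : Function.Surjective c := by
      rw [← LinearMap.range_eq_top, eq_top_iff]
      let b := (Finsupp.basisSingleOne (R := 𝕜) (ι := ZMod n)).tensorProduct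
        (Finsupp.basisSingleOne (R := 𝕜) (ι := ZMod n))
      rw [← b.span_eq, Submodule.span_le]
      rintro _ ⟨⟨p, q⟩, rfl⟩
      refine ⟨(ε * ξ ^ (2 * i * (m - i - (-p) - (q + 2 * p))).val)⁻¹ •
        (Finsupp.single (q + 2 * p) (1 : 𝕜) ⊗ₜ[𝕜] Finsupp.single (-p) (1 : 𝕜)), ?_⟩
      rw [map_smul, hc, smul_smul, inv_mul_cancel₀ (mul_ne_zero hε0 (pow_ne_zero _ hξ0)), one_smul]
      simp [b, Module.Basis.tensorProduct_apply]
    have : FiniteDimensional 𝕜 ((ZMod n →₀ 𝕜) ⊗[𝕜] (ZMod n →₀ 𝕜)) := inferInstance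
    exact ⟨OrzechProperty.injective_of_surjective_endomorphism c hs, hs⟩
  · have hL : ∀ a b d : ZMod n, braidL c (Finsupp.single a (1 : 𝕜) ⊗ₜ[𝕜]
        (Finsupp.single b (1 : 𝕜) ⊗ₜ[𝕜] Finsupp.single d (1 : 𝕜))) =
        (ε * ξ ^ (2 * i * (m - i - b - a)).val) • (Finsupp.single (-b) (1 : 𝕜) ⊗ₜ[𝕜]
        (Finsupp.single (a + 2 * b) (1 : 𝕜) ⊗ₜ[𝕜] Finsupp.single d (1 : 𝕜))) := by
      intro a b d
      simp only [braidL, LinearMap.comp_apply, LinearEquiv.coe_coe, TensorProduct.assoc_symm_tmul,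
        LinearMap.rTensor_tmul, hc, ← TensorProduct.smul_tmul', map_smul, TensorProduct.assoc_tmul]
    have hR : ∀ a b d : ZMod n, braidR c (Finsupp.single a (1 : 𝕜) ⊗ₜ[𝕜]
        (Finsupp.single b (1 : 𝕜) ⊗ₜ[𝕜] Finsupp.single d (1 : 𝕜))) =
        (ε * ξ ^ (2 * i * (m - i - d - b)).val) • (Finsupp.single a (1 : 𝕜) ⊗ₜ[𝕜]
        (Finsupp.single (-d) (1 : 𝕜) ⊗ₜ[𝕜] Finsupp.single (b + 2 * d) (1 : 𝕜))) := by
      intro a b d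
      simp only [braidR, LinearMap.lTensor_tmul, hc, TensorProduct.tmul_smul]
    let e := Finsupp.basisSingleOne (R := 𝕜) (ι := ZMod n)
    refine (e.tensorProduct (e.tensorProduct e)).ext ?_
    rintro ⟨a, b, d⟩
    have key : ∀ x y z : ZMod n, ((ε * ξ ^ x.val) * (ε * ξ ^ y.val)) * (ε * ξ ^ z.val)
        = ε ^ 3 * ξ ^ (x + y + z).val := by
      intro x y z
      rw [← hadd, ← hadd]; ring
    simp only [e, Module.Basis.tensorProduct_apply, Finsupp.coe_basisSingleOne,
      LinearMap.comp_apply, hL, hR, map_smul, smul_smul, key]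
    congr 1
    · congr 3; ring
    · congr 3
      all_goals first | ring | (congr 1; ring) | (congr 2; ring)
end

section
/- Let n ≥ 3 be odd, 𝕜 a field containing a primitive n-th root of unity ξ, ε ∈ {+1, −1}, and i, m ∈ ℤ_n. Define q : ℤ_n × ℤ_n → 𝕜ˣ by q(ℓ, r) = ε ξ^{2i(m − i − ℓ + r)}, and let x ▷ y = 2x − y be the dihedral rack operation on ℤ_n. Then q is a rack 2-cocycle, i.e. q(x, y ▷ z) · q(y, z) = q(x ▷ y, x ▷ z) · q(x, z) for all x, y, z ∈ ℤ_n; moreover q(ℓ, r) = F(f_r^{−1}(ℓ), r) where F(ℓ, r) = ε ξ^{2i(m − i − ℓ − r)} and f_r(ℓ) = ℓ + 2r. -/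
theorem stmt5 (n : ℕ) (hn : 3 ≤ n) (hodd : Odd n)
    {𝕜 : Type*} [Field 𝕜] (ξ : 𝕜) (hξ : IsPrimitiveRoot ξ n)
    (ε : 𝕜) (hε : ε = 1 ∨ ε = -1) (i m : ZMod n)
    (q F : ZMod n → ZMod n → 𝕜)
    (hq : ∀ ℓ r : ZMod n, q ℓ r = ε * ξ ^ (2 * i * (m - i - ℓ + r)).val)
    (hF : ∀ ℓ r : ZMod n, F ℓ r = ε * ξ ^ (2 * i * (m - i - ℓ - r)).val) :
    -- rack 2-cocycle condition for the dihedral rack `x ▷ y = 2x − y`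
    (∀ x y z : ZMod n,
      q x (2 * y - z) * q y z = q (2 * x - y) (2 * x - z) * q x z) ∧
    -- `q(ℓ, r) = F(f_r⁻¹(ℓ), r)` where `f_r(ℓ) = ℓ + 2r`
    (∀ ℓ r : ZMod n, q ℓ r = F (ℓ - 2 * r) r) := by
  haveI : NeZero n := ⟨by omega⟩
  have key : ∀ a b : ZMod n, ξ ^ a.val * ξ ^ b.val = ξ ^ (a + b).val := by
    intro a b
    rw [← pow_add, ZMod.val_add]
    exact pow_eq_pow_mod _ hξ.pow_eq_one
  refine ⟨fun x y z => ?_, fun ℓ r => ?_⟩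
  · simp only [hq]
    rw [mul_mul_mul_comm, key, mul_mul_mul_comm, key]
    congr 3
    ring
  · rw [hq, hF]
    congr 3
    ring
end

section
/- Let 𝕜 be a field containing a primitive 3rd root of unity ξ, and let i, k ∈ ℤ_3. Define φ : ℤ_3 × ℤ_3 → 𝕜ˣ by φ(ℓ, r) = ξ^{(i−k)(ℓ − 2r)}, and let x ▷ y = 2x − y on ℤ_3. Then: (1) ξ^{−2k(ℓ+r)} · φ(ℓ + 2r, r) = ξ^{−2i(ℓ+r)} · φ(2ℓ − r, ℓ) for all ℓ, r ∈ ℤ_3; and (2) φ satisfies the twist cocycle condition φ(x, z) φ(x ▷ y, x ▷ z) φ(x ▷ (y ▷ z), x) φ(y ▷ z, y) = φ(y, z) φ(x, y ▷ z) φ(x ▷ (y ▷ z), x ▷ y) φ(x ▷ z, x) for all x, y, z ∈ ℤ_3. -/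
theorem pow_val_mul_aux {K : Type*} [Field K] (ξ : K) (h : ξ ^ 3 = 1) (a b : ZMod 3) :
    ξ ^ a.val * ξ ^ b.val = ξ ^ (a + b).val := by
  rw [← pow_add, ZMod.val_add]
  exact pow_eq_pow_mod _ h

theorem stmt6 {𝕜 : Type*} [Field 𝕜] (ξ : 𝕜) (hξ : IsPrimitiveRoot ξ 3)
    (i k : ZMod 3)
    (φ : ZMod 3 → ZMod 3 → 𝕜)
    (hφ : ∀ ℓ r : ZMod 3, φ ℓ r = ξ ^ ((i - k) * (ℓ - 2 * r)).val) :
    -- (1) the twist-equivalence equation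
    (∀ ℓ r : ZMod 3,
      ξ ^ (-(2 * k * (ℓ + r))).val * φ (ℓ + 2 * r) r
        = ξ ^ (-(2 * i * (ℓ + r))).val * φ (2 * ℓ - r) ℓ) ∧
    -- (2) the twist cocycle condition for the dihedral rack `x ▷ y = 2x − y`
    (∀ x y z : ZMod 3,
      φ x z * φ (2 * x - y) (2 * x - z) * φ (2 * x - (2 * y - z)) x * φ (2 * y - z) y
        = φ y z * φ x (2 * y - z) * φ (2 * x - (2 * y - z)) (2 * x - y) * φ (2 * x - z) x) := by
  have h3 : (3 : ZMod 3) = 0 := by decide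
  have hm := pow_val_mul_aux ξ hξ.pow_eq_one
  refine ⟨fun ℓ r => ?_, fun x y z => ?_⟩
  · simp only [hφ, hm]
    congr 2
    linear_combination ((i - k) * (ℓ + r)) * h3
  · simp only [hφ, hm]
    congr 2
    revert i k x y z
    intro i k _ x y z
    generalize i - k = d
    revert d x y z
    decide
end

section
/- Let n ≥ 3 be odd and 𝕜 a field containing a primitive n-th root of unity ξ. For i, j ∈ ℤ_n define the function e_{ij} : ℤ_n × ℤ_n → 𝕜 by e_{ij}(p, q) = ξ^{−(i+j)(p+q)} if p − q = 2(i − j), and e_{ij}(p, q) = 0 otherwise (equivalently, e_{ij} = Σ_{k ∈ ℤ_n} ξ^{−2(i+j)k} δ_{(k+i−j, k−i+j)}, where δ_{(a,b)} is the indicator function of the point (a, b)). Then the family (e_{ij})_{i,j ∈ ℤ_n} of n² functions is linearly independent over 𝕜. -/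
/-- The function `e_{ij} : ℤ_n × ℤ_n → 𝕜`,
`e_{ij}(p, q) = ξ^{−(i+j)(p+q)}` if `p − q = 2(i − j)` and `0` otherwise. -/
noncomputable def eFun (n : ℕ) {𝕜 : Type*} [Field 𝕜] (ξ : 𝕜) (i j : ZMod n) :
    ZMod n × ZMod n → 𝕜 :=
  fun p => if p.1 - p.2 = 2 * (i - j) then ξ ^ (-(i + j) * (p.1 + p.2)).val else 0

theorem stmt7 (n : ℕ) (hn : 3 ≤ n) (hodd : Odd n)
    {𝕜 : Type*} [Field 𝕜] (ξ : 𝕜) (hξ : IsPrimitiveRoot ξ n) :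
    LinearIndependent 𝕜 (fun ij : ZMod n × ZMod n => eFun n ξ ij.1 ij.2) := by
  haveI : NeZero n := ⟨by omega⟩
  obtain ⟨h, hh⟩ : ∃ h : ZMod n, 2 * h = 1 := by
    have hu : IsUnit ((2 : ℕ) : ZMod n) :=
      (ZMod.isUnit_iff_coprime 2 n).2 (Nat.coprime_two_left.2 hodd)
    obtain ⟨b, hb⟩ := hu.exists_right_inv
    exact ⟨b, by simpa using hb⟩
  have c2 : ∀ a b : ZMod n, 2 * a = 2 * b → a = b := fun a b hab => by
    linear_combination h * hab - (a - b) * hh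
  let ψ : AddChar (ZMod n) 𝕜 := AddChar.zmodChar n hξ.pow_eq_one
  have hψ : ψ.IsPrimitive := AddChar.zmodChar_primitive_of_primitive_root n hξ
  have hinj := AddChar.to_mulShift_inj_of_isPrimitive hψ
  rw [Fintype.linearIndependent_iff]
  rintro g hg ⟨i0, j0⟩
  let f : ZMod n → (Multiplicative (ZMod n) →* 𝕜) := fun j =>
    (AddChar.mulShift ψ (-(2 * j + (i0 - j0)))).toMonoidHom
  have hf : Function.Injective f := by
    intro a b hab
    have h1 : AddChar.mulShift ψ (-(2 * a + (i0 - j0))) = AddChar.mulShift ψ (-(2 * b + (i0 - j0))) := by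
      ext x
      exact DFunLike.congr_fun hab (Multiplicative.ofAdd x)
    have h2 := hinj h1
    apply c2
    linear_combination -h2
  have hli := (linearIndependent_monoidHom (Multiplicative (ZMod n)) 𝕜).comp f hf
  rw [Fintype.linearIndependent_iff] at hli
  have key := hli (fun j => g (j + (i0 - j0), j)) ?_ j0
  · simpa using key
  ext t
  have ht := congrFun hg (h * t.toAdd + (i0 - j0), h * t.toAdd - (i0 - j0))
  simp only [Finset.sum_apply, Pi.smul_apply, smul_eq_mul, Pi.zero_apply, Function.comp] at ht ⊢
  rw [← ht, Fintype.sum_prod_type_right]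
  refine Finset.sum_congr rfl fun j _ => ?_
  rw [Finset.sum_eq_single (j + (i0 - j0))]
  · have e1 : h * t.toAdd + (i0 - j0) + (h * t.toAdd - (i0 - j0)) = t.toAdd := by
      linear_combination t.toAdd * hh
    have e2 : h * t.toAdd + (i0 - j0) - (h * t.toAdd - (i0 - j0)) = 2 * (j + (i0 - j0) - j) := by
      ring
    have e3 : j + (i0 - j0) + j = 2 * j + (i0 - j0) := by ring
    simp only [eFun]
    rw [if_pos e2, e1, e3]
    rfl
  · intro b _ hb
    simp only [eFun]
    rw [if_neg, mul_zero]
    intro hc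
    apply hb
    apply c2
    linear_combination -hc
  · simp
end

section
/- Let n ≥ 3 be odd and 𝕜 a field containing a primitive n-th root of unity ξ. For i, j ∈ ℤ_n define e_{ij} : ℤ_n × ℤ_n → 𝕜 by e_{ij}(p, q) = ξ^{−(i+j)(p+q)} if p − q = 2(i − j), and 0 otherwise. Then for all i, j ∈ ℤ_n and all p₁, q₁, p₂, q₂ ∈ ℤ_n one has ξ^{p₁q₂ − q₁p₂} · e_{ij}(p₁ + p₂, q₁ + q₂) = Σ_{r ∈ ℤ_n} e_{ir}(p₁, q₁) · e_{rj}(p₂, q₂), and moreover e_{ij}(0, 0) = 1 if i = j and 0 otherwise. (These identities express that in the Hopf algebra K_n, where Δ(f_{ab}) = Σ_{a'+a''=a, b'+b''=b} ξ^{a'b''−b'a''} f_{a'b'} ⊗ f_{a''b''}, the elements e_{ij} = Σ_k ξ^{−2(i+j)k} f_{k+i−j, k−i+j} form a comatrix basis: Δ(e_{ij}) = Σ_r e_{ir} ⊗ e_{rj} and ε(e_{ij}) = δ_{ij}.) -/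
theorem stmt8 (n : ℕ) [NeZero n] (hn : 3 ≤ n) (hodd : Odd n)
    {𝕜 : Type*} [Field 𝕜] (ξ : 𝕜) (hξ : IsPrimitiveRoot ξ n) :
    -- comatrix comultiplication: `Δ(e_{ij}) = Σ_r e_{ir} ⊗ e_{rj}` in coefficients
    (∀ i j p₁ q₁ p₂ q₂ : ZMod n,
      ξ ^ (p₁ * q₂ - q₁ * p₂).val * eFun n ξ i j (p₁ + p₂, q₁ + q₂)
        = ∑ r : ZMod n, eFun n ξ i r (p₁, q₁) * eFun n ξ r j (p₂, q₂)) ∧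
    -- counit: `ε(e_{ij}) = δ_{ij}`
    (∀ i j : ZMod n, eFun n ξ i j (0, 0) = if i = j then 1 else 0) := by
  have hadd : ∀ a b : ZMod n, ξ ^ (a + b).val = ξ ^ a.val * ξ ^ b.val := by
    intro a b
    rw [ZMod.val_add, ← pow_add, ← pow_mod_orderOf ξ (a.val + b.val), ← hξ.eq_orderOf]
  obtain ⟨c, hc⟩ : ∃ c : ZMod n, c * 2 = 1 := by
    have h : Nat.Coprime 2 n := (Nat.coprime_two_left).2 hodd
    refine ⟨(2 : ZMod n)⁻¹, ?_⟩
    have := ZMod.coe_mul_inv_eq_one 2 h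
    rw [mul_comm]
    exact_mod_cast this
  have hcan : ∀ a b : ZMod n, 2 * a = 2 * b → a = b := by
    intro a b h
    linear_combination c * h - (a - b) * hc
  refine ⟨?_, ?_⟩
  · intro i j p₁ q₁ p₂ q₂
    rw [Finset.sum_eq_single (i - c * (p₁ - q₁))]
    · have h1 : p₁ - q₁ = 2 * (i - (i - c * (p₁ - q₁))) := by
        linear_combination -(p₁ - q₁) * hc
      simp only [eFun]
      rw [if_pos h1]
      by_cases h : p₂ - q₂ = 2 * (i - c * (p₁ - q₁) - j)
      · rw [if_pos h, if_pos (by linear_combination h + h1), ← hadd, ← hadd]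
        congr 2
        apply hcan
        linear_combination (-(p₁ + q₁)) * h - (p₂ + q₂) * (p₁ - q₁) * hc
      · rw [if_neg h, if_neg (fun h' => h (by linear_combination h' - h1))]
        simp
    · intro r _ hr
      simp only [eFun]
      rw [if_neg, zero_mul]
      intro h
      apply hr
      linear_combination c * h + (i - r) * hc
    · simp
  · intro i j
    simp only [eFun]
    by_cases h : i = j
    · simp [h]
    · rw [if_neg, if_neg h]
      intro h'
      apply h
      apply hcan
      linear_combination -h'
end

section
/- Let 𝕜 be a field containing a primitive 3rd root of unity ξ. Let V be the free 𝕜-module with basis x_0, x_1, x_2 and let W be the free 𝕜-module with basis w_0, w_1, w_2, with indices in ℤ_3. Define d_0 : V ⊗ V → V ⊗ V by d_0(x_ℓ ⊗ x_r) = −x_{2ℓ−r} ⊗ x_ℓ and c : W ⊗ W → W ⊗ W by c(w_ℓ ⊗ w_r) = −w_{−r} ⊗ w_{ℓ+2r} for all ℓ, r ∈ ℤ_3. Then the linear map φ : V → W determined by φ(x_k) = w_0 + ξ^k w_1 + ξ^{2k} w_2 is a bijection and satisfies (φ ⊗ φ) ∘ d_0 = c ∘ (φ ⊗ φ); that is,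 φ is an isomorphism of braided vector spaces from (V, d_0) to (W^−_{0,m}, c^−_{0,m}). -/
open TensorProduct

theorem stmt9 {𝕜 : Type*} [Field 𝕜] (ξ : 𝕜) (hξ : IsPrimitiveRoot ξ 3)
    (d₀ : (ZMod 3 →₀ 𝕜) ⊗[𝕜] (ZMod 3 →₀ 𝕜) →ₗ[𝕜] (ZMod 3 →₀ 𝕜) ⊗[𝕜] (ZMod 3 →₀ 𝕜))
    (hd₀ : ∀ ℓ r : ZMod 3,
      d₀ (Finsupp.single ℓ (1 : 𝕜) ⊗ₜ[𝕜] Finsupp.single r (1 : 𝕜))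
        = -(Finsupp.single (2 * ℓ - r) (1 : 𝕜) ⊗ₜ[𝕜] Finsupp.single ℓ (1 : 𝕜)))
    (c : (ZMod 3 →₀ 𝕜) ⊗[𝕜] (ZMod 3 →₀ 𝕜) →ₗ[𝕜] (ZMod 3 →₀ 𝕜) ⊗[𝕜] (ZMod 3 →₀ 𝕜))
    (hc : ∀ ℓ r : ZMod 3,
      c (Finsupp.single ℓ (1 : 𝕜) ⊗ₜ[𝕜] Finsupp.single r (1 : 𝕜))
        = -(Finsupp.single (-r) (1 : 𝕜) ⊗ₜ[𝕜] Finsupp.single (ℓ + 2 * r) (1 : 𝕜)))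
    (φ : (ZMod 3 →₀ 𝕜) →ₗ[𝕜] (ZMod 3 →₀ 𝕜))
    (hφ : ∀ k : ZMod 3,
      φ (Finsupp.single k (1 : 𝕜))
        = Finsupp.single 0 (1 : 𝕜) + Finsupp.single 1 (ξ ^ k.val)
            + Finsupp.single 2 (ξ ^ (2 * k).val)) :
    Function.Bijective φ ∧
    TensorProduct.map φ φ ∘ₗ d₀ = c ∘ₗ TensorProduct.map φ φ := by
  have h3 : ξ ^ 3 = 1 := hξ.pow_eq_one
  have hne : ξ - 1 ≠ 0 := sub_ne_zero.mpr (hξ.ne_one (by norm_num))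
  have hs : 1 + ξ + ξ ^ 2 = 0 := by
    apply mul_left_cancel₀ hne
    linear_combination h3
  have h30 : (3 : 𝕜) ≠ 0 := by
    intro h
    apply hne
    have : (ξ - 1) ^ 3 = 0 := by linear_combination h3 + (ξ - ξ ^ 2) * h
    exact pow_eq_zero_iff (by norm_num) |>.mp this
  have hsm : ∀ (i : ZMod 3) (a : 𝕜), Finsupp.single i a = a • Finsupp.single i (1 : 𝕜) := by
    intro i a; simp
  have q0 : (0 : ZMod 3).val = 0 := rfl
  have q1 : (1 : ZMod 3).val = 1 := rfl
  have q2 : (2 : ZMod 3).val = 2 := rfl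
  have r2 : (2 * 2 : ZMod 3) = 1 := rfl
  have p0 := hφ 0
  have p1 := hφ 1
  have p2 := hφ 2
  rw [hsm 1 (ξ ^ _), hsm 2 (ξ ^ _)] at p0 p1 p2
  simp only [mul_zero, mul_one, r2, q0, q1, q2, pow_zero, pow_one, one_smul] at p0 p1 p2
  have cases3 : ∀ P : ZMod 3 → Prop, P 0 → P 1 → P 2 → ∀ k, P k := by
    intro P h0 h1 h2 k
    fin_cases k
    · exact h0
    · exact h1
    · exact h2
  constructor
  · have hsurj : Function.Surjective φ := by
      rw [← LinearMap.range_eq_top, eq_top_iff, ← (Finsupp.basisSingleOne (R := 𝕜) (ι := ZMod 3)).span_eq,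
        Submodule.span_le]
      rintro _ ⟨k, rfl⟩
      rw [Finsupp.coe_basisSingleOne]
      revert k
      have e : ∀ x y : ZMod 3 →₀ 𝕜, φ x = (3 : 𝕜) • y → y ∈ LinearMap.range φ := by
        intro x y h
        refine ⟨(3 : 𝕜)⁻¹ • x, ?_⟩
        rw [map_smul, h, smul_smul, inv_mul_cancel₀ h30, one_smul]
      apply cases3
      · apply e (Finsupp.single 0 1 + Finsupp.single 1 1 + Finsupp.single 2 1)
        simp only [map_add, p0, p1, p2]
        match_scalars
        · norm_num
        · linear_combination hs
        · linear_combination hs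
      · apply e (Finsupp.single 0 1 + ξ ^ 2 • Finsupp.single 1 1 + ξ • Finsupp.single 2 1)
        simp only [map_add, map_smul, p0, p1, p2]
        match_scalars
        · linear_combination hs
        · linear_combination 2 * h3
        · linear_combination hs + ξ * h3
      · apply e (Finsupp.single 0 1 + ξ • Finsupp.single 1 1 + ξ ^ 2 • Finsupp.single 2 1)
        simp only [map_add, map_smul, p0, p1, p2]
        match_scalars
        · linear_combination hs
        · linear_combination hs + ξ * h3
        · linear_combination 2 * h3
    exact ⟨LinearMap.injective_iff_surjective.mpr hsurj, hsurj⟩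
  · have m1 : ξ * ξ ^ 2 = 1 := by linear_combination h3
    have m2 : ξ ^ 2 * ξ = 1 := by linear_combination h3
    have m3 : ξ ^ 2 * ξ ^ 2 = ξ := by linear_combination ξ * h3
    have m4 : ξ * ξ = ξ ^ 2 := by ring
    have n1 : (-1 : ZMod 3) = 2 := rfl
    have n2 : (-2 : ZMod 3) = 1 := rfl
    have n3 : (1 + 2 : ZMod 3) = 0 := rfl
    have n4 : (2 + 2 : ZMod 3) = 1 := rfl
    have n5 : (2 + 1 : ZMod 3) = 0 := rfl
    have n6 : (1 + 1 : ZMod 3) = 2 := rfl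
    have n7 : (2 - 1 : ZMod 3) = 1 := rfl
    have n8 : (1 - 2 : ZMod 3) = 2 := rfl
    have hT : ∀ a b : ZMod 3 →₀ 𝕜, -(a ⊗ₜ[𝕜] b) = (-1 : 𝕜) • (a ⊗ₜ[𝕜] b) := by
      intro a b
      rw [TensorProduct.smul_tmul', neg_one_smul]
      exact (TensorProduct.neg_tmul a b).symm
    simp only [hT] at hc hd₀
    have key : ∀ l r : ZMod 3, TensorProduct.map φ φ (d₀ (Finsupp.single l 1 ⊗ₜ Finsupp.single r 1))
        = c (TensorProduct.map φ φ (Finsupp.single l 1 ⊗ₜ Finsupp.single r 1)) := by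
      intro l r
      rw [hd₀]
      revert l r
      apply cases3 <;> apply cases3 <;>
      · simp only [ TensorProduct.map_tmul, mul_zero, mul_one, r2, sub_zero, zero_sub,
          n1, n2, n7, n8, sub_self, p0, p1, p2, TensorProduct.add_tmul, TensorProduct.tmul_add,
          ← TensorProduct.smul_tmul', TensorProduct.tmul_smul, map_add, map_smul, hc, neg_zero,
          zero_add, add_zero, n3, n4, n5, n6, smul_smul, m1, m2, m3, m4, one_smul, smul_add]
        module
    apply TensorProduct.ext
    apply Finsupp.lhom_ext'
    intro l
    apply LinearMap.ext_ring
    apply Finsupp.lhom_ext'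
    intro r
    apply LinearMap.ext_ring
    exact key l r
end

section
/- Let 𝕜 be a field of characteristic zero or coprime to 6 containing a primitive 3rd root of unity ξ. Let A be the quotient of the free associative 𝕜-algebra on generators w_0, w_1, w_2 by the two-sided ideal generated by w_0², w_1w_2, w_2w_1, w_0w_1 + w_1w_0 + w_2², and w_0w_2 + w_2w_0 + w_1². Then A is isomorphic as a 𝕜-algebra to the Fomin–Kirillov algebra ℰ_3, via the algebra map determined by x_k ↦ w_0 + ξ^k w_1 + ξ^{2k} w_2 for k = 0, 1, 2. -/
/-- Relations presenting the algebra `A`: `w₀²`, `w₁w₂`, `w₂w₁`,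
`w₀w₁ + w₁w₀ + w₂²`, `w₀w₂ + w₂w₀ + w₁²`. -/
inductive ARel (𝕜 : Type*) [Field 𝕜] :
    FreeAlgebra 𝕜 (Fin 3) → FreeAlgebra 𝕜 (Fin 3) → Prop
  | r1 : ARel 𝕜 (FreeAlgebra.ι 𝕜 0 * FreeAlgebra.ι 𝕜 0) 0
  | r2 : ARel 𝕜 (FreeAlgebra.ι 𝕜 1 * FreeAlgebra.ι 𝕜 2) 0
  | r3 : ARel 𝕜 (FreeAlgebra.ι 𝕜 2 * FreeAlgebra.ι 𝕜 1) 0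
  | r4 : ARel 𝕜 (FreeAlgebra.ι 𝕜 0 * FreeAlgebra.ι 𝕜 1 + FreeAlgebra.ι 𝕜 1 * FreeAlgebra.ι 𝕜 0
      + FreeAlgebra.ι 𝕜 2 * FreeAlgebra.ι 𝕜 2) 0
  | r5 : ARel 𝕜 (FreeAlgebra.ι 𝕜 0 * FreeAlgebra.ι 𝕜 2 + FreeAlgebra.ι 𝕜 2 * FreeAlgebra.ι 𝕜 0
      + FreeAlgebra.ι 𝕜 1 * FreeAlgebra.ι 𝕜 1) 0

/-- Relations presenting the Fomin–Kirillov algebra `ℰ₃`: `x₀²`, `x₁²`, `x₂²`,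
`x₀x₁ + x₁x₂ + x₂x₀`, `x₀x₂ + x₂x₁ + x₁x₀`. -/
inductive FKRel (𝕜 : Type*) [Field 𝕜] :
    FreeAlgebra 𝕜 (Fin 3) → FreeAlgebra 𝕜 (Fin 3) → Prop
  | r1 : FKRel 𝕜 (FreeAlgebra.ι 𝕜 0 * FreeAlgebra.ι 𝕜 0) 0
  | r2 : FKRel 𝕜 (FreeAlgebra.ι 𝕜 1 * FreeAlgebra.ι 𝕜 1) 0
  | r3 : FKRel 𝕜 (FreeAlgebra.ι 𝕜 2 * FreeAlgebra.ι 𝕜 2) 0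
  | r4 : FKRel 𝕜 (FreeAlgebra.ι 𝕜 0 * FreeAlgebra.ι 𝕜 1 + FreeAlgebra.ι 𝕜 1 * FreeAlgebra.ι 𝕜 2
      + FreeAlgebra.ι 𝕜 2 * FreeAlgebra.ι 𝕜 0) 0
  | r5 : FKRel 𝕜 (FreeAlgebra.ι 𝕜 0 * FreeAlgebra.ι 𝕜 2 + FreeAlgebra.ι 𝕜 2 * FreeAlgebra.ι 𝕜 1
      + FreeAlgebra.ι 𝕜 1 * FreeAlgebra.ι 𝕜 0) 0

theorem aux_x {𝕜 B : Type*} [Field 𝕜] [Ring B] [Algebra 𝕜 B] (ξ : 𝕜) (h : ξ ^ 2 + ξ + 1 = 0)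
    (a b c : B) (h1 : a * a = 0) (h2 : b * c = 0) (h3 : c * b = 0)
    (h4 : a * b + b * a + c * c = 0) (h5 : a * c + c * a + b * b = 0) (x : Fin 3 → B)
    (hx : ∀ k : Fin 3, x k = a + ξ ^ (k : ℕ) • b + ξ ^ (2 * (k : ℕ)) • c) :
    x 0 * x 0 = 0 ∧ x 1 * x 1 = 0 ∧ x 2 * x 2 = 0 ∧ x 0 * x 1 + x 1 * x 2 + x 2 * x 0 = 0 ∧
      x 0 * x 2 + x 2 * x 1 + x 1 * x 0 = 0 := by
  have h4' : c * c = - (a * b) - b * a := by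
    rw [← sub_eq_zero, ← h4]; abel
  have h5' : b * b = - (a * c) - c * a := by
    rw [← sub_eq_zero, ← h5]; abel
  refine ⟨?_, ?_, ?_, ?_, ?_⟩ <;>
  · simp only [hx, add_mul, mul_add, smul_mul_assoc, mul_smul_comm, h1, h2, h3, h4', h5']
    simp only [Fin.val_zero, Fin.val_one, Fin.val_two]
    match_scalars <;> grind

theorem aux_w {𝕜 B : Type*} [Field 𝕜] [Ring B] [Algebra 𝕜 B] (ξ : 𝕜) (h : ξ ^ 2 + ξ + 1 = 0)
    (t : 𝕜) (a b c : B) (h1 : a * a = 0) (h2 : b * b = 0) (h3 : c * c = 0)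
    (h4 : a * b + b * c + c * a = 0) (h5 : a * c + c * b + b * a = 0) (w : Fin 3 → B)
    (hw : ∀ k : Fin 3, w k = t • (a + ξ ^ (2 * (k : ℕ)) • b + ξ ^ (k : ℕ) • c)) :
    w 0 * w 0 = 0 ∧ w 1 * w 2 = 0 ∧ w 2 * w 1 = 0 ∧ w 0 * w 1 + w 1 * w 0 + w 2 * w 2 = 0 ∧
      w 0 * w 2 + w 2 * w 0 + w 1 * w 1 = 0 := by
  have h4' : c * a = - (a * b) - b * c := by
    rw [← sub_eq_zero, ← h4]; abel
  have h5' : b * a = - (a * c) - c * b := by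
    rw [← sub_eq_zero, ← h5]; abel
  refine ⟨?_, ?_, ?_, ?_, ?_⟩ <;>
  · simp only [hw, add_mul, mul_add, smul_mul_assoc, mul_smul_comm, h1, h2, h3, h4', h5']
    simp only [Fin.val_zero, Fin.val_one, Fin.val_two]
    match_scalars <;> grind

set_option maxHeartbeats 2000000 in
theorem stmt10 {𝕜 : Type*} [Field 𝕜] (hchar : (6 : 𝕜) ≠ 0)
    (ξ : 𝕜) (hξ : IsPrimitiveRoot ξ 3) :
    ∃ ψ : RingQuot (FKRel 𝕜) →ₐ[𝕜] RingQuot (ARel 𝕜),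
      (∀ k : Fin 3,
        ψ (RingQuot.mkAlgHom 𝕜 (FKRel 𝕜) (FreeAlgebra.ι 𝕜 k))
          = RingQuot.mkAlgHom 𝕜 (ARel 𝕜)
              (FreeAlgebra.ι 𝕜 0 + ξ ^ (k : ℕ) • FreeAlgebra.ι 𝕜 1
                + ξ ^ (2 * (k : ℕ)) • FreeAlgebra.ι 𝕜 2)) ∧
      Function.Bijective ψ := by
  have h : ξ ^ 2 + ξ + 1 = 0 := by
    have h3 := hξ.pow_eq_one
    have h1 : ξ - 1 ≠ 0 := sub_ne_zero.2 (hξ.ne_one (by norm_num))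
    apply mul_left_cancel₀ h1
    linear_combination h3
  have h30 : (3 : 𝕜) ≠ 0 := fun h3 => hchar (by linear_combination 2 * h3)
  obtain ⟨t, ht⟩ : ∃ t : 𝕜, 3 * t = 1 := ⟨3⁻¹, mul_inv_cancel₀ h30⟩
  let πA := RingQuot.mkAlgHom 𝕜 (ARel 𝕜)
  let πF := RingQuot.mkAlgHom 𝕜 (FKRel 𝕜)
  let w : Fin 3 → RingQuot (ARel 𝕜) := fun k => πA (FreeAlgebra.ι 𝕜 k)
  let x : Fin 3 → RingQuot (FKRel 𝕜) := fun k => πF (FreeAlgebra.ι 𝕜 k)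
  let X : Fin 3 → RingQuot (ARel 𝕜) :=
    fun k => w 0 + ξ ^ (k : ℕ) • w 1 + ξ ^ (2 * (k : ℕ)) • w 2
  let V : Fin 3 → RingQuot (FKRel 𝕜) :=
    fun k => t • (x 0 + ξ ^ (2 * (k : ℕ)) • x 1 + ξ ^ (k : ℕ) • x 2)
  have ra : ∀ {p}, ARel 𝕜 p 0 → πA p = 0 := fun hp => by
    simpa using RingQuot.mkAlgHom_rel 𝕜 hp
  have rf : ∀ {p}, FKRel 𝕜 p 0 → πF p = 0 := fun hp => by
    simpa using RingQuot.mkAlgHom_rel 𝕜 hp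
  obtain ⟨a1, a2, a3, a4, a5⟩ := aux_x ξ h (w 0) (w 1) (w 2)
    (by simpa using ra ARel.r1) (by simpa using ra ARel.r2) (by simpa using ra ARel.r3)
    (by simpa using ra ARel.r4) (by simpa using ra ARel.r5) X (fun _ => rfl)
  obtain ⟨b1, b2, b3, b4, b5⟩ := aux_w ξ h t (x 0) (x 1) (x 2)
    (by simpa using rf FKRel.r1) (by simpa using rf FKRel.r2) (by simpa using rf FKRel.r3)
    (by simpa using rf FKRel.r4) (by simpa using rf FKRel.r5) V (fun _ => rfl)
  let ψ : RingQuot (FKRel 𝕜) →ₐ[𝕜] RingQuot (ARel 𝕜) :=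
    RingQuot.liftAlgHom 𝕜 ⟨FreeAlgebra.lift 𝕜 X, by
      intro p q hpq
      cases hpq <;> simpa using by assumption⟩
  let φ : RingQuot (ARel 𝕜) →ₐ[𝕜] RingQuot (FKRel 𝕜) :=
    RingQuot.liftAlgHom 𝕜 ⟨FreeAlgebra.lift 𝕜 V, by
      intro p q hpq
      cases hpq <;> simpa using by assumption⟩
  have hψ : ∀ k, ψ (x k) = X k := fun k => by simp [ψ, x, πF]
  have hφ : ∀ k, φ (w k) = V k := fun k => by simp [φ, w, πA]
  have e1 : φ.comp ψ = AlgHom.id 𝕜 _ := by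
    apply RingQuot.ringQuot_ext'
    ext k
    change φ (ψ (x k)) = x k
    rw [hψ]
    simp only [X, map_add, map_smul, hφ, V]
    fin_cases k <;> simp only [Fin.zero_eta, Fin.mk_one, Fin.reduceFinMk, Fin.val_zero, Fin.val_one, Fin.val_two] <;>
    match_scalars <;> grind
  have e2 : ψ.comp φ = AlgHom.id 𝕜 _ := by
    apply RingQuot.ringQuot_ext'
    ext k
    change ψ (φ (w k)) = w k
    rw [hφ]
    simp only [V, map_add, map_smul, hψ, X]
    fin_cases k <;> simp only [Fin.zero_eta, Fin.mk_one, Fin.reduceFinMk, Fin.val_zero, Fin.val_one, Fin.val_two] <;>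
    match_scalars <;> grind
  refine ⟨ψ, fun k => ?_, ?_⟩
  · simpa [X, w, πA] using hψ k
  · exact Function.bijective_iff_has_inverse.2
      ⟨φ, fun y => DFunLike.congr_fun e1 y, fun y => DFunLike.congr_fun e2 y⟩
end

section
/- Let 𝕜 be a field of characteristic zero or coprime to 6 containing a primitive 3rd root of unity ξ. For each k ∈ {0, 1, 2}, the algebra 𝔅_{ξ^k}, defined as the quotient of the free associative 𝕜-algebra on generators w_0, w_1, w_2 by the two-sided ideal generated by w_0², w_1w_2, w_2w_1, ξ^{2k}w_0w_2 + w_2w_0 + ξ^k w_1², and ξ^{2k}w_0w_1 + ξ^k w_1w_0 + w_2², has dimension 12 as a 𝕜-vector space. -/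
/-- Relations presenting the algebra `𝔅_q` (for `q = ξ^k`): `w₀²`, `w₁w₂`, `w₂w₁`,
`q²w₀w₂ + w₂w₀ + q w₁²`, `q²w₀w₁ + q w₁w₀ + w₂²`. -/
inductive BRel (𝕜 : Type*) [Field 𝕜] (q : 𝕜) :
    FreeAlgebra 𝕜 (Fin 3) → FreeAlgebra 𝕜 (Fin 3) → Prop
  | r1 : BRel 𝕜 q (FreeAlgebra.ι 𝕜 0 * FreeAlgebra.ι 𝕜 0) 0
  | r2 : BRel 𝕜 q (FreeAlgebra.ι 𝕜 1 * FreeAlgebra.ι 𝕜 2) 0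
  | r3 : BRel 𝕜 q (FreeAlgebra.ι 𝕜 2 * FreeAlgebra.ι 𝕜 1) 0
  | r4 : BRel 𝕜 q (q ^ 2 • (FreeAlgebra.ι 𝕜 0 * FreeAlgebra.ι 𝕜 2)
      + FreeAlgebra.ι 𝕜 2 * FreeAlgebra.ι 𝕜 0
      + q • (FreeAlgebra.ι 𝕜 1 * FreeAlgebra.ι 𝕜 1)) 0
  | r5 : BRel 𝕜 q (q ^ 2 • (FreeAlgebra.ι 𝕜 0 * FreeAlgebra.ι 𝕜 1)
      + q • (FreeAlgebra.ι 𝕜 1 * FreeAlgebra.ι 𝕜 0)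
      + FreeAlgebra.ι 𝕜 2 * FreeAlgebra.ι 𝕜 2) 0

namespace BAux

variable {𝕜 : Type*} [Field 𝕜]

/-- Left multiplication by `w₀` in the basis `1,u,u²,u³,v,v²` and `w₀` times these. -/
def W0 : Module.End 𝕜 (Fin 12 → 𝕜) where
  toFun a := ![0, 0, 0, 0, 0, 0, a 0, a 1, a 2, a 3, a 4, a 5]
  map_add' a b := by ext i; fin_cases i <;> simp
  map_smul' r a := by ext i; fin_cases i <;> simp

/-- Left multiplication by `u = w₁`. -/
def W1 (q : 𝕜) : Module.End 𝕜 (Fin 12 → 𝕜) where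
  toFun a := ![0, a 0, a 1, a 2 - q ^ 2 * a 10, 0, -q ^ 2 * a 6,
    0, -q * a 6, -q * a 7, -q * a 8, 0, 0]
  map_add' a b := by ext i; fin_cases i <;> simp <;> ring
  map_smul' r a := by ext i; fin_cases i <;> simp <;> ring

/-- Left multiplication by `v = w₂`. -/
def W2 (q : 𝕜) : Module.End 𝕜 (Fin 12 → 𝕜) where
  toFun a := ![0, 0, -q * a 6, a 5 - q * a 7, a 0, a 4,
    0, 0, 0, -q ^ 2 * a 11, -q ^ 2 * a 6, -q ^ 2 * a 10]
  map_add' a b := by ext i; fin_cases i <;> simp <;> ring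
  map_smul' r a := by ext i; fin_cases i <;> simp <;> ring

/-- The three operators. -/
def W (q : 𝕜) : Fin 3 → Module.End 𝕜 (Fin 12 → 𝕜) := ![W0, W1 q, W2 q]

lemma W0_apply (a : Fin 12 → 𝕜) :
    W0 a = ![0, 0, 0, 0, 0, 0, a 0, a 1, a 2, a 3, a 4, a 5] := rfl
lemma W1_apply (q : 𝕜) (a : Fin 12 → 𝕜) :
    W1 q a = ![0, a 0, a 1, a 2 - q ^ 2 * a 10, 0, -q ^ 2 * a 6,
    0, -q * a 6, -q * a 7, -q * a 8, 0, 0] := rfl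
lemma W2_apply (q : 𝕜) (a : Fin 12 → 𝕜) :
    W2 q a = ![0, 0, -q * a 6, a 5 - q * a 7, a 0, a 4,
    0, 0, 0, -q ^ 2 * a 11, -q ^ 2 * a 6, -q ^ 2 * a 10] := rfl

lemma rel_W (q : 𝕜) (hq : q ^ 3 = 1) (x y : FreeAlgebra 𝕜 (Fin 3)) (h : BRel 𝕜 q x y) :
    FreeAlgebra.lift 𝕜 (W q) x = FreeAlgebra.lift 𝕜 (W q) y := by
  cases h <;> refine LinearMap.ext fun a => funext fun i => ?_ <;>
    fin_cases i <;> simp [W, W0_apply, W1_apply, W2_apply] <;> grind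

/-- The representation. -/
def φ (q : 𝕜) (hq : q ^ 3 = 1) : RingQuot (BRel 𝕜 q) →ₐ[𝕜] Module.End 𝕜 (Fin 12 → 𝕜) :=
  RingQuot.liftAlgHom 𝕜 ⟨FreeAlgebra.lift 𝕜 (W q), fun x y h => rel_W q hq x y h⟩

/-- The generators. -/
def w (q : 𝕜) (i : Fin 3) : RingQuot (BRel 𝕜 q) :=
  RingQuot.mkAlgHom 𝕜 (BRel 𝕜 q) (FreeAlgebra.ι 𝕜 i)

lemma φ_w (q : 𝕜) (hq : q ^ 3 = 1) (i : Fin 3) : φ q hq (w q i) = W q i := by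
  simp [φ, w]

/-- The monomials. -/
def mon (q : 𝕜) : Fin 12 → RingQuot (BRel 𝕜 q) :=
  ![1, w q 1, w q 1 * w q 1, w q 1 * (w q 1 * w q 1), w q 2, w q 2 * w q 2,
    w q 0, w q 0 * w q 1, w q 0 * (w q 1 * w q 1), w q 0 * (w q 1 * (w q 1 * w q 1)),
    w q 0 * w q 2, w q 0 * (w q 2 * w q 2)]

/-- The parametrisation. -/
def g (q : 𝕜) : (Fin 12 → 𝕜) →ₗ[𝕜] RingQuot (BRel 𝕜 q) :=
  Fintype.linearCombination 𝕜 (mon q)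

lemma g_apply (q : 𝕜) (c : Fin 12 → 𝕜) : g q c =
    c 0 • 1 + c 1 • w q 1 + c 2 • (w q 1 * w q 1) + c 3 • (w q 1 * (w q 1 * w q 1))
    + c 4 • w q 2 + c 5 • (w q 2 * w q 2) + c 6 • w q 0 + c 7 • (w q 0 * w q 1)
    + c 8 • (w q 0 * (w q 1 * w q 1)) + c 9 • (w q 0 * (w q 1 * (w q 1 * w q 1)))
    + c 10 • (w q 0 * w q 2) + c 11 • (w q 0 * (w q 2 * w q 2)) := by
  simp only [g, Fintype.linearCombination_apply, Fin.sum_univ_succ, mon]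
  simp [add_assoc]

lemma h00 (q : 𝕜) : w q 0 * w q 0 = 0 := by
  simpa [w] using RingQuot.mkAlgHom_rel 𝕜 (BRel.r1 (𝕜 := 𝕜) (q := q))
lemma h12 (q : 𝕜) : w q 1 * w q 2 = 0 := by
  simpa [w] using RingQuot.mkAlgHom_rel 𝕜 (BRel.r2 (𝕜 := 𝕜) (q := q))
lemma h21 (q : 𝕜) : w q 2 * w q 1 = 0 := by
  simpa [w] using RingQuot.mkAlgHom_rel 𝕜 (BRel.r3 (𝕜 := 𝕜) (q := q))
lemma h20 (q : 𝕜) : w q 2 * w q 0 = (-q ^ 2) • (w q 0 * w q 2) + (-q) • (w q 1 * w q 1) := by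
  have h : q ^ 2 • (w q 0 * w q 2) + w q 2 * w q 0 + q • (w q 1 * w q 1) = 0 := by
    simpa [w] using RingQuot.mkAlgHom_rel 𝕜 (BRel.r4 (𝕜 := 𝕜) (q := q))
  calc w q 2 * w q 0 = (-q ^ 2) • (w q 0 * w q 2) + (-q) • (w q 1 * w q 1)
      + (q ^ 2 • (w q 0 * w q 2) + w q 2 * w q 0 + q • (w q 1 * w q 1)) := by module
    _ = _ := by rw [h, add_zero]
lemma h10 (q : 𝕜) (hq : q ^ 3 = 1) :
    w q 1 * w q 0 = (-q) • (w q 0 * w q 1) + (-q ^ 2) • (w q 2 * w q 2) := by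
  have h : q ^ 2 • (w q 0 * w q 1) + q • (w q 1 * w q 0) + w q 2 * w q 2 = 0 := by
    simpa [w] using RingQuot.mkAlgHom_rel 𝕜 (BRel.r5 (𝕜 := 𝕜) (q := q))
  have h2 := congrArg (fun z => q ^ 2 • z) h
  simp only [smul_add, smul_smul, smul_zero] at h2
  rw [show q ^ 2 * q ^ 2 = q by linear_combination q * hq,
    show q ^ 2 * q = 1 by linear_combination hq, one_smul] at h2
  calc w q 1 * w q 0 = (-q) • (w q 0 * w q 1) + (-q ^ 2) • (w q 2 * w q 2)
      + (q • (w q 0 * w q 1) + w q 1 * w q 0 + q ^ 2 • (w q 2 * w q 2)) := by module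
    _ = _ := by rw [h2, add_zero]

lemma h222 (q : 𝕜) (hq : q ^ 3 = 1) :
    w q 2 * (w q 2 * w q 2) = w q 1 * (w q 1 * w q 1) := by
  have h : w q 2 * (w q 1 * w q 0) = 0 := by rw [← mul_assoc, h21, zero_mul]
  rw [h10 q hq, mul_add, mul_smul_comm, mul_smul_comm, ← mul_assoc (w q 2) (w q 0),
    h20, add_mul, smul_mul_assoc, smul_mul_assoc, mul_assoc (w q 0), h21] at h
  simp only [mul_zero, smul_zero, zero_add, smul_smul, mul_assoc] at h
  have hh := congrArg (fun z => q • z) h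
  simp only [smul_add, smul_smul, smul_zero] at hh
  rw [show q * (-q * -q) = 1 by linear_combination hq,
    show q * -q ^ 2 = -1 by linear_combination -hq, one_smul] at hh
  calc w q 2 * (w q 2 * w q 2) = w q 2 * (w q 2 * w q 2) + 0 := by rw [add_zero]
    _ = _ := by rw [← hh]; module

lemma mul_of {q : 𝕜} {a b c : RingQuot (BRel 𝕜 q)} (h : a * b = c) (m : RingQuot (BRel 𝕜 q)) :
    a * (b * m) = c * m := by rw [← mul_assoc, h]

lemma h1111 (q : 𝕜) (hq : q ^ 3 = 1) : w q 1 * (w q 1 * (w q 1 * w q 1)) = 0 := by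
  rw [← h222 q hq, ← mul_assoc, h12, zero_mul]

lemma g_W (q : 𝕜) (hq : q ^ 3 = 1) (i : Fin 3) (c : Fin 12 → 𝕜) :
    g q (W q i c) = w q i * g q c := by
  have e : q ^ 4 = q := by linear_combination q * hq
  rw [g_apply, g_apply]
  fin_cases i
  · simp [W, W0_apply, mul_add, h00, mul_of (h00 q)]
    try module
  · simp [-neg_smul, smul_mul_assoc, W, W1_apply, mul_add, h12, mul_of (h12 q), h10 q hq, mul_of (h10 q hq), add_mul,
      mul_assoc, h222 q hq, h21, mul_of (h21 q), h1111 q hq]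
    try module
  · simp [-neg_smul, smul_mul_assoc, W, W2_apply, mul_add, h12, mul_of (h12 q), h20 q, mul_of (h20 q), add_mul,
      mul_assoc, h222 q hq, h21, mul_of (h21 q), h1111 q hq]
    try module

lemma g_φ (q : 𝕜) (hq : q ^ 3 = 1) (a : RingQuot (BRel 𝕜 q)) (c : Fin 12 → 𝕜) :
    g q (φ q hq a c) = a * g q c := by
  obtain ⟨a, rfl⟩ := RingQuot.mkAlgHom_surjective 𝕜 (BRel 𝕜 q) a
  induction a using FreeAlgebra.induction generalizing c with
  | grade0 r =>
    rw [AlgHom.commutes, AlgHom.commutes, Module.algebraMap_end_apply, map_smul,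
      Algebra.smul_def]
  | grade1 i => 
    have := g_W q hq i c
    rwa [← φ_w q hq] at this
  | mul a b ha hb => simp only [map_mul, Module.End.mul_apply, ha, hb, mul_assoc]
  | add a b ha hb => simp only [map_add, LinearMap.add_apply, ha, hb, add_mul]

lemma φ_g (q : 𝕜) (hq : q ^ 3 = 1) (c : Fin 12 → 𝕜) :
    φ q hq (g q c) (Pi.single 0 1) = c := by
  rw [g_apply]
  simp only [map_add, map_smul, map_mul, map_one, φ_w, LinearMap.add_apply, LinearMap.smul_apply,
    Module.End.mul_apply, Module.End.one_apply, Pi.add_apply, Pi.smul_apply]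
  ext i
  simp only [Pi.add_apply, Pi.smul_apply]
  fin_cases i <;> simp [W, W0_apply, W1_apply, W2_apply]

lemma main (q : 𝕜) (hq : q ^ 3 = 1) : Module.finrank 𝕜 (RingQuot (BRel 𝕜 q)) = 12 := by
  have hb : Function.Bijective (g q) := by
    refine ⟨Function.LeftInverse.injective (g := fun a => φ q hq a (Pi.single 0 1)) (φ_g q hq),
      fun a => ⟨φ q hq a (Pi.single 0 1), ?_⟩⟩
    rw [g_φ, g_apply]
    simp
  rw [← (LinearEquiv.ofBijective (g q) hb).finrank_eq]
  simp

end BAux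

theorem stmt11 {𝕜 : Type*} [Field 𝕜] (hchar : (6 : 𝕜) ≠ 0)
    (ξ : 𝕜) (hξ : IsPrimitiveRoot ξ 3) :
    ∀ k : Fin 3, Module.finrank 𝕜 (RingQuot (BRel 𝕜 (ξ ^ (k : ℕ)))) = 12 := by
  intro k
  apply BAux.main
  rw [← pow_mul, mul_comm, pow_mul, hξ.pow_eq_one, one_pow]
end

section
/- Let 𝕜 be a field of characteristic zero or coprime to 6 containing a primitive 3rd root of unity ξ. Then the algebras 𝔅_ξ and 𝔅_{ξ²} are isomorphic as 𝕜-algebras, where 𝔅_{ξ^k} is the quotient of the free associative 𝕜-algebra on w_0, w_1, w_2 by the ideal generated by w_0², w_1w_2, w_2w_1, ξ^{2k}w_0w_2 + w_2w_0 + ξ^k w_1², and ξ^{2k}w_0w_1 + ξ^k w_1w_0 + w_2². -/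
noncomputable def swapGen (𝕜 : Type*) [Field 𝕜] (p : 𝕜) : Fin 3 → RingQuot (BRel 𝕜 p) :=
  fun i => RingQuot.mkAlgHom 𝕜 (BRel 𝕜 p) (FreeAlgebra.ι 𝕜 (Equiv.swap (1 : Fin 3) 2 i))

theorem swap_rel {𝕜 : Type*} [Field 𝕜] (q p : 𝕜) (h1 : q ^ 2 = p) (h2 : p ^ 2 = q)
    (h3 : q * p = 1) ⦃x y : FreeAlgebra 𝕜 (Fin 3)⦄ (h : BRel 𝕜 q x y) :
    FreeAlgebra.lift 𝕜 (swapGen 𝕜 p) x = FreeAlgebra.lift 𝕜 (swapGen 𝕜 p) y := by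
  have e0 : Equiv.swap (1 : Fin 3) 2 0 = 0 := by decide
  have R1 := RingQuot.mkAlgHom_rel 𝕜 (BRel.r1 (𝕜 := 𝕜) (q := p))
  have R2 := RingQuot.mkAlgHom_rel 𝕜 (BRel.r2 (𝕜 := 𝕜) (q := p))
  have R3 := RingQuot.mkAlgHom_rel 𝕜 (BRel.r3 (𝕜 := 𝕜) (q := p))
  have R4 := congrArg (fun z => q • z) (RingQuot.mkAlgHom_rel 𝕜 (BRel.r4 (𝕜 := 𝕜) (q := p)))
  have R5 := congrArg (fun z => q • z) (RingQuot.mkAlgHom_rel 𝕜 (BRel.r5 (𝕜 := 𝕜) (q := p)))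
  simp only [map_add, map_mul, map_smul, map_zero, smul_add, smul_smul, smul_zero, h1, h2, h3,
    ← pow_two q] at R1 R2 R3 R4 R5
  cases h <;>
    simp only [map_add, map_mul, map_smul, map_zero, FreeAlgebra.lift_ι_apply, swapGen, e0,
      Equiv.swap_apply_left, Equiv.swap_apply_right, h1]
  · exact R1
  · exact R3
  · exact R2
  · rw [one_smul] at R5
    exact R5
  · rw [one_smul] at R4
    exact R4

noncomputable def swapHom {𝕜 : Type*} [Field 𝕜] (q p : 𝕜) (h1 : q ^ 2 = p) (h2 : p ^ 2 = q)
    (h3 : q * p = 1) : RingQuot (BRel 𝕜 q) →ₐ[𝕜] RingQuot (BRel 𝕜 p) :=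
  RingQuot.liftAlgHom 𝕜 ⟨FreeAlgebra.lift 𝕜 (swapGen 𝕜 p), swap_rel q p h1 h2 h3⟩

theorem swapHom_comp {𝕜 : Type*} [Field 𝕜] (q p : 𝕜) (h1 : q ^ 2 = p) (h2 : p ^ 2 = q)
    (h3 : q * p = 1) (h4 : p * q = 1) :
    (swapHom p q h2 h1 h4).comp (swapHom q p h1 h2 h3) = AlgHom.id 𝕜 _ := by
  apply RingQuot.ringQuot_ext'
  apply FreeAlgebra.hom_ext
  funext i
  simp [swapHom, swapGen]

theorem stmt12 {𝕜 : Type*} [Field 𝕜] (hchar : (6 : 𝕜) ≠ 0)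
    (ξ : 𝕜) (hξ : IsPrimitiveRoot ξ 3) :
    Nonempty (RingQuot (BRel 𝕜 ξ) ≃ₐ[𝕜] RingQuot (BRel 𝕜 (ξ ^ 2))) := by
  have h : ξ ^ 3 = 1 := hξ.pow_eq_one
  have h2 : (ξ ^ 2) ^ 2 = ξ := by linear_combination ξ * h
  have h3 : ξ * ξ ^ 2 = 1 := by linear_combination h
  have h4 : ξ ^ 2 * ξ = 1 := by linear_combination h
  exact ⟨AlgEquiv.ofAlgHom (swapHom ξ (ξ ^ 2) rfl h2 h3) (swapHom (ξ ^ 2) ξ h2 rfl h4)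
    (swapHom_comp _ _ _ _ _ _) (swapHom_comp _ _ _ _ _ _)⟩
end

section
/- Let 𝕜 be a field of characteristic zero or coprime to 6 containing a primitive 3rd root of unity ξ (so ξ ≠ 1). Then the algebras 𝔅_1 and 𝔅_ξ are NOT isomorphic as 𝕜-algebras, where 𝔅_1 is the quotient of the free 𝕜-algebra on w_0, w_1, w_2 by the ideal generated by w_0², w_1w_2, w_2w_1, w_0w_2 + w_2w_0 + w_1², w_0w_1 + w_1w_0 + w_2², and 𝔅_ξ is the quotient of the free 𝕜-algebra on w_0, w_1, w_2 by the ideal generated by w_0², w_1w_2, w_2w_1, ξ²w_0w_2 + w_2w_0 + ξw_1², ξ²w_0w_1 + ξw_1w_0 + w_2². -/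
def PM {𝕜 : Type*} [Field 𝕜] (a c x y z t : 𝕜) : Matrix (Fin 5) (Fin 5) 𝕜 :=
  !![c, x, y, z, t; 0, c, 0, 0, a * z; 0, 0, c, 0, y; 0, 0, 0, c, -(a * x); 0, 0, 0, 0, c]

theorem PM_mul {𝕜 : Type*} [Field 𝕜] (a c x y z t c' x' y' z' t' : 𝕜) :
    PM a c x y z t * PM a c' x' y' z' t' =
      PM a (c * c') (c * x' + x * c') (c * y' + y * c') (c * z' + z * c')
        (c * t' + x * (a * z') + y * y' - z * (a * x') + t * c') := by
  ext i j
  fin_cases i <;> fin_cases j <;> simp [PM, Matrix.mul_apply, Fin.sum_univ_succ] <;> ring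

theorem PM_add {𝕜 : Type*} [Field 𝕜] (a c x y z t c' x' y' z' t' : 𝕜) :
    PM a c x y z t + PM a c' x' y' z' t' =
      PM a (c + c') (x + x') (y + y') (z + z') (t + t') := by
  ext i j
  fin_cases i <;> fin_cases j <;> simp [PM] <;> ring

theorem PM_smul {𝕜 : Type*} [Field 𝕜] (r a c x y z t : 𝕜) :
    r • PM a c x y z t = PM a (r * c) (r * x) (r * y) (r * z) (r * t) := by
  ext i j
  fin_cases i <;> fin_cases j <;> simp [PM] <;> ring

theorem PM_zero {𝕜 : Type*} [Field 𝕜] (a : 𝕜) : PM a 0 0 0 0 0 = 0 := by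
  ext i j
  fin_cases i <;> fin_cases j <;> simp [PM]

theorem PM_alg {𝕜 : Type*} [Field 𝕜] (a r : 𝕜) :
    algebraMap 𝕜 (Matrix (Fin 5) (Fin 5) 𝕜) r = PM a r 0 0 0 0 := by
  rw [Algebra.algebraMap_eq_smul_one]
  ext i j
  fin_cases i <;> fin_cases j <;> simp [PM]

def genM {𝕜 : Type*} [Field 𝕜] (a : 𝕜) : Fin 3 → Matrix (Fin 5) (Fin 5) 𝕜 :=
  ![PM a 0 1 0 0 0, PM a 0 0 1 0 0, PM a 0 0 0 1 0]

theorem genM_rel {𝕜 : Type*} [Field 𝕜] (a ξ : 𝕜) (ha : ξ ^ 2 * a - a + ξ = 0)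
    ⦃p q : FreeAlgebra 𝕜 (Fin 3)⦄ (h : BRel 𝕜 ξ p q) :
    FreeAlgebra.lift 𝕜 (genM a) p = FreeAlgebra.lift 𝕜 (genM a) q := by
  have ha' : ξ ^ 2 * a + -a + ξ = 0 := by linear_combination ha
  cases h <;> simp [genM, PM_mul, PM_add, PM_smul, PM_zero, ha']

noncomputable def rho {𝕜 : Type*} [Field 𝕜] (a ξ : 𝕜) (ha : ξ ^ 2 * a - a + ξ = 0) :
    RingQuot (BRel 𝕜 ξ) →ₐ[𝕜] Matrix (Fin 5) (Fin 5) 𝕜 :=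
  RingQuot.liftAlgHom 𝕜 ⟨FreeAlgebra.lift 𝕜 (genM a), genM_rel a ξ ha⟩

theorem rho_form {𝕜 : Type*} [Field 𝕜] (a ξ : 𝕜) (ha : ξ ^ 2 * a - a + ξ = 0)
    (b : RingQuot (BRel 𝕜 ξ)) : ∃ c x y z t, rho a ξ ha b = PM a c x y z t := by
  obtain ⟨p, rfl⟩ := RingQuot.mkAlgHom_surjective 𝕜 (BRel 𝕜 ξ) b
  induction p using FreeAlgebra.induction with
  | grade0 r => exact ⟨r, 0, 0, 0, 0, by rw [AlgHom.commutes, AlgHom.commutes, PM_alg a]⟩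
  | grade1 i =>
    have h : rho a ξ ha (RingQuot.mkAlgHom 𝕜 (BRel 𝕜 ξ) (FreeAlgebra.ι 𝕜 i)) = genM a i := by
      simp [rho]
    rw [h]
    fin_cases i
    · exact ⟨_, _, _, _, _, rfl⟩
    · exact ⟨_, _, _, _, _, rfl⟩
    · exact ⟨_, _, _, _, _, rfl⟩
  | mul p q hp hq =>
    obtain ⟨c, x, y, z, t, h⟩ := hp
    obtain ⟨c', x', y', z', t', h'⟩ := hq
    rw [map_mul, map_mul, h, h', PM_mul]
    exact ⟨_, _, _, _, _, rfl⟩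
  | add p q hp hq =>
    obtain ⟨c, x, y, z, t, h⟩ := hp
    obtain ⟨c', x', y', z', t', h'⟩ := hq
    rw [map_add, map_add, h, h', PM_add]
    exact ⟨_, _, _, _, _, rfl⟩

theorem PM_02 {𝕜 : Type*} [Field 𝕜] (a c x y z t : 𝕜) : PM a c x y z t 0 2 = y := by
  simp [PM]

theorem rho_sq {𝕜 : Type*} [Field 𝕜] (a ξ : 𝕜) (ha : ξ ^ 2 * a - a + ξ = 0)
    (b : RingQuot (BRel 𝕜 ξ)) (hb : b * b = 0) : rho a ξ ha b 0 2 = 0 := by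
  obtain ⟨c, x, y, z, t, h⟩ := rho_form a ξ ha b
  have h2 : rho a ξ ha b * rho a ξ ha b = 0 := by rw [← map_mul, hb, map_zero]
  rw [h, PM_mul] at h2
  have hc := congrFun (congrFun h2 0) 0
  have ht := congrFun (congrFun h2 0) 4
  simp [PM] at hc ht
  subst hc
  rw [h, PM_02]
  have : y * y = 0 := by linear_combination ht
  simpa using this

theorem stmt13 {𝕜 : Type*} [Field 𝕜] (hchar : (6 : 𝕜) ≠ 0)
    (ξ : 𝕜) (hξ : IsPrimitiveRoot ξ 3) :
    IsEmpty (RingQuot (BRel 𝕜 1) ≃ₐ[𝕜] RingQuot (BRel 𝕜 ξ)) := by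
  refine ⟨fun φ => ?_⟩
  have h1 : ξ ≠ 1 := hξ.ne_one (by norm_num)
  have h3 : ξ ^ 3 = 1 := hξ.pow_eq_one
  have h0 : ξ ≠ 0 := hξ.ne_zero (by norm_num)
  have h2 : 1 - ξ ^ 2 ≠ 0 := by
    intro h
    apply h1
    linear_combination h3 + ξ * h
  have ha : ξ ^ 2 * (ξ / (1 - ξ ^ 2)) - (ξ / (1 - ξ ^ 2)) + ξ = 0 := by
    field_simp
    ring
  generalize ξ / (1 - ξ ^ 2) = a at ha
  let w : Fin 3 → RingQuot (BRel 𝕜 1) := fun i =>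
    RingQuot.mkAlgHom 𝕜 (BRel 𝕜 1) (FreeAlgebra.ι 𝕜 i)
  have r1 : w 0 * w 0 = 0 := by
    simpa [w] using RingQuot.mkAlgHom_rel 𝕜 (BRel.r1 (𝕜 := 𝕜) (q := 1))
  have r2 : w 1 * w 2 = 0 := by
    simpa [w] using RingQuot.mkAlgHom_rel 𝕜 (BRel.r2 (𝕜 := 𝕜) (q := 1))
  have r3 : w 2 * w 1 = 0 := by
    simpa [w] using RingQuot.mkAlgHom_rel 𝕜 (BRel.r3 (𝕜 := 𝕜) (q := 1))
  have r4 : w 0 * w 2 + w 2 * w 0 + w 1 * w 1 = 0 := by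
    simpa [w] using RingQuot.mkAlgHom_rel 𝕜 (BRel.r4 (𝕜 := 𝕜) (q := 1))
  have r5 : w 0 * w 1 + w 1 * w 0 + w 2 * w 2 = 0 := by
    simpa [w] using RingQuot.mkAlgHom_rel 𝕜 (BRel.r5 (𝕜 := 𝕜) (q := 1))
  have key : ∀ s : 𝕜, s ^ 3 = 1 →
      (w 0 + s • w 1 + s ^ 2 • w 2) * (w 0 + s • w 1 + s ^ 2 • w 2) = 0 := by
    intro s hs
    have e4 : s ^ 2 * s ^ 2 = s := by linear_combination s * hs
    have : (w 0 + s • w 1 + s ^ 2 • w 2) * (w 0 + s • w 1 + s ^ 2 • w 2)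
        = w 0 * w 0 + (s ^ 2 * s) • (w 1 * w 2) + (s * s ^ 2) • (w 2 * w 1)
          + s ^ 2 • (w 0 * w 2 + w 2 * w 0 + w 1 * w 1)
          + s • (w 0 * w 1 + w 1 * w 0) + (s ^ 2 * s ^ 2) • (w 2 * w 2) := by
      simp only [add_mul, mul_add, smul_mul_assoc, mul_smul_comm, smul_smul, smul_add]
      rw [← pow_two s]
      abel
    rw [this, r1, r2, r3, r4, e4, add_assoc, ← smul_add, r5]
    simp
  let D : RingQuot (BRel 𝕜 1) → 𝕜 := fun b => rho a ξ ha (φ b) 0 2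
  have Dsq : ∀ b, b * b = 0 → D b = 0 := fun b hb =>
    rho_sq a ξ ha _ (by rw [← map_mul, hb, map_zero])
  have d0 : D (w 0) = 0 := Dsq _ r1
  have d1 := Dsq _ (key 1 (by simp))
  have d2 := Dsq _ (key ξ h3)
  have Dlin : ∀ s : 𝕜, D (w 0 + s • w 1 + s ^ 2 • w 2) = D (w 0) + s * D (w 1) + s ^ 2 * D (w 2) := by
    intro s
    simp [D]
  rw [Dlin, d0] at d1 d2
  have hd1 : D (w 1) = 0 := by
    have : (ξ * (1 - ξ)) * D (w 1) = 0 := by linear_combination d2 - ξ ^ 2 * d1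
    rcases mul_eq_zero.mp this with h | h
    · exact absurd h (mul_ne_zero h0 (sub_ne_zero.mpr h1.symm))
    · exact h
  have hd2 : D (w 2) = 0 := by linear_combination d1 - hd1
  have hall : ∀ b, D b = 0 := by
    intro b
    obtain ⟨p, rfl⟩ := RingQuot.mkAlgHom_surjective 𝕜 (BRel 𝕜 1) b
    induction p using FreeAlgebra.induction with
    | grade0 r =>
      simp only [D]
      rw [AlgHom.commutes, AlgEquiv.commutes, AlgHom.commutes, PM_alg a, PM_02]
    | grade1 i =>
      fin_cases i
      · exact d0
      · exact hd1
      · exact hd2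
    | mul p q hp hq =>
      simp only [D] at hp hq ⊢
      rw [map_mul, map_mul, map_mul]
      obtain ⟨c, x, y, z, t, h⟩ := rho_form a ξ ha (φ (RingQuot.mkAlgHom 𝕜 (BRel 𝕜 1) p))
      obtain ⟨c', x', y', z', t', h'⟩ := rho_form a ξ ha (φ (RingQuot.mkAlgHom 𝕜 (BRel 𝕜 1) q))
      rw [h, PM_02] at hp
      rw [h', PM_02] at hq
      rw [h, h', PM_mul, PM_02, hp, hq]
      ring
    | add p q hp hq =>
      simp only [D] at hp hq ⊢
      rw [map_add, map_add, map_add, Matrix.add_apply, hp, hq, add_zero]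
  have hf := hall (φ.symm (RingQuot.mkAlgHom 𝕜 (BRel 𝕜 ξ) (FreeAlgebra.ι 𝕜 1)))
  simp [D, rho, genM, PM_02] at hf
end

section
/- Let 𝕜 be a field of characteristic zero or coprime to 6 containing a primitive 3rd root of unity ξ, and let 𝔅_1 be the quotient of the free 𝕜-algebra on w_0, w_1, w_2 by the ideal generated by w_0², w_1w_2, w_2w_1, w_0w_2 + w_2w_0 + w_1², w_0w_1 + w_1w_0 + w_2². Then the elements a = w_0, b = w_0 + ξw_1 + ξ²w_2, and c = w_0 + ξ²w_1 + ξw_2 of 𝔅_1 satisfy a² = b² = c² = 0, and a, b, c generate 𝔅_1 as a 𝕜-algebra. -/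
theorem stmt14 {𝕜 : Type*} [Field 𝕜] (hchar : (6 : 𝕜) ≠ 0)
    (ξ : 𝕜) (hξ : IsPrimitiveRoot ξ 3)
    (a b c : RingQuot (BRel 𝕜 1))
    (ha : a = RingQuot.mkAlgHom 𝕜 (BRel 𝕜 1) (FreeAlgebra.ι 𝕜 0))
    (hb : b = RingQuot.mkAlgHom 𝕜 (BRel 𝕜 1)
      (FreeAlgebra.ι 𝕜 0 + ξ • FreeAlgebra.ι 𝕜 1 + ξ ^ 2 • FreeAlgebra.ι 𝕜 2))
    (hc : c = RingQuot.mkAlgHom 𝕜 (BRel 𝕜 1)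
      (FreeAlgebra.ι 𝕜 0 + ξ ^ 2 • FreeAlgebra.ι 𝕜 1 + ξ • FreeAlgebra.ι 𝕜 2)) :
    a ^ 2 = 0 ∧ b ^ 2 = 0 ∧ c ^ 2 = 0 ∧ Algebra.adjoin 𝕜 {a, b, c} = ⊤ := by
  have h3 : ξ ^ 3 = 1 := hξ.pow_eq_one
  have h4 : ξ * ξ ^ 3 = ξ := by rw [h3, mul_one]
  have h1 : (1 - ξ) ≠ 0 := sub_ne_zero.mpr (hξ.ne_one (by norm_num)).symm
  have e1 := RingQuot.mkAlgHom_rel 𝕜 (BRel.r1 (𝕜 := 𝕜) (q := 1))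
  have e2 := RingQuot.mkAlgHom_rel 𝕜 (BRel.r2 (𝕜 := 𝕜) (q := 1))
  have e3 := RingQuot.mkAlgHom_rel 𝕜 (BRel.r3 (𝕜 := 𝕜) (q := 1))
  have e4 := RingQuot.mkAlgHom_rel 𝕜 (BRel.r4 (𝕜 := 𝕜) (q := 1))
  have e5 := RingQuot.mkAlgHom_rel 𝕜 (BRel.r5 (𝕜 := 𝕜) (q := 1))
  have htop : Algebra.adjoin 𝕜 (Set.range fun i : Fin 3 =>
      RingQuot.mkAlgHom 𝕜 (BRel 𝕜 1) (FreeAlgebra.ι 𝕜 i)) = ⊤ := by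
    have h := congrArg (Subalgebra.map (RingQuot.mkAlgHom 𝕜 (BRel 𝕜 1)))
      (FreeAlgebra.adjoin_range_ι 𝕜 (Fin 3))
    rw [AlgHom.map_adjoin, ← Set.range_comp, Algebra.map_top,
      (AlgHom.range_eq_top _).mpr (RingQuot.mkAlgHom_surjective 𝕜 _)] at h
    exact h
  simp only [map_add, map_mul, map_smul, map_zero, one_pow, one_smul] at e1 e2 e3 e4 e5 hb hc
  generalize hw0 : RingQuot.mkAlgHom 𝕜 (BRel 𝕜 1) (FreeAlgebra.ι 𝕜 0) = w0 at *
  generalize hw1 : RingQuot.mkAlgHom 𝕜 (BRel 𝕜 1) (FreeAlgebra.ι 𝕜 1) = w1 at *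
  generalize hw2 : RingQuot.mkAlgHom 𝕜 (BRel 𝕜 1) (FreeAlgebra.ι 𝕜 2) = w2 at *
  refine ⟨by rw [ha, sq, e1], ?_, ?_, ?_⟩
  · have : b ^ 2 = w0 * w0 + ξ • (w0 * w1 + w1 * w0 + ξ ^ 3 • (w2 * w2))
        + ξ ^ 2 • (w0 * w2 + w2 * w0 + w1 * w1) + ξ ^ 3 • (w1 * w2 + w2 * w1) := by
      rw [hb, sq]
      simp only [add_mul, mul_add, smul_mul_assoc, mul_smul_comm, smul_add]
      module
    rw [this, h3, one_smul, one_smul, e1, e2, e3, e4, e5]; simp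
  · have : c ^ 2 = w0 * w0 + ξ ^ 2 • (w0 * w1 + w1 * w0 + w2 * w2)
        + ξ • (w0 * w2 + w2 * w0 + ξ ^ 3 • (w1 * w1)) + ξ ^ 3 • (w1 * w2 + w2 * w1) := by
      rw [hc, sq]
      simp only [add_mul, mul_add, smul_mul_assoc, mul_smul_comm, smul_add]
      module
    rw [this, h3, one_smul, one_smul, e1, e2, e3, e4, e5]; simp
  · have ma : a ∈ Algebra.adjoin 𝕜 {a, b, c} := Algebra.subset_adjoin (by simp)
    have mb : b ∈ Algebra.adjoin 𝕜 {a, b, c} := Algebra.subset_adjoin (by simp)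
    have mc : c ∈ Algebra.adjoin 𝕜 {a, b, c} := Algebra.subset_adjoin (by simp)
    have k1 : w1 = (1 - ξ)⁻¹ • (ξ • (c - a) - (b - a)) := by
      rw [eq_inv_smul_iff₀ h1]
      have : ξ • (c - a) - (b - a) = (ξ ^ 3 - ξ) • w1 := by
        rw [ha, hb, hc]; module
      rw [this, h3]
    have k2 : w2 = (1 - ξ)⁻¹ • (ξ • (b - a) - (c - a)) := by
      rw [eq_inv_smul_iff₀ h1]
      have : ξ • (b - a) - (c - a) = (ξ ^ 3 - ξ) • w2 := by
        rw [ha, hb, hc]; module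
      rw [this, h3]
    rw [eq_top_iff, ← htop, Algebra.adjoin_le_iff]
    rintro _ ⟨i, rfl⟩
    fin_cases i
    · have : w0 ∈ Algebra.adjoin 𝕜 {a, b, c} := ha ▸ ma
      simpa [hw0] using this
    · have : w1 ∈ Algebra.adjoin 𝕜 {a, b, c} := by
        rw [k1]
        exact Subalgebra.smul_mem _ (sub_mem (Subalgebra.smul_mem _ (sub_mem mc ma) _)
          (sub_mem mb ma)) _
      simpa [hw1] using this
    · have : w2 ∈ Algebra.adjoin 𝕜 {a, b, c} := by
        rw [k2]
        exact Subalgebra.smul_mem _ (sub_mem (Subalgebra.smul_mem _ (sub_mem mb ma) _)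
          (sub_mem mc ma)) _
      simpa [hw2] using this
end

section
/- Let 𝕜 be a field of characteristic zero or coprime to 6 containing a primitive 3rd root of unity ξ, and let 𝔅_ξ be the quotient of the free 𝕜-algebra on w_0, w_1, w_2 by the ideal generated by w_0², w_1w_2, w_2w_1, ξ²w_0w_2 + w_2w_0 + ξw_1², ξ²w_0w_1 + ξw_1w_0 + w_2². If λ_0, λ_1, λ_2 ∈ 𝕜 are such that the element x = λ_0w_0 + λ_1w_1 + λ_2w_2 satisfies x² = 0 in 𝔅_ξ, then λ_1 = λ_2 = 0; that is, the only square-zero elements in the span of w_0, w_1, w_2 in 𝔅_ξ are the scalar multiples of w_0. -/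
def repM {𝕜 : Type*} [Field 𝕜] (f : Fin 3 → Fin 3 → 𝕜) (i : Fin 3) : Matrix (Fin 5) (Fin 5) 𝕜 :=
  !![0, f i 0, f i 1, f i 2, 0;
     0, 0, 0, 0, if i = 0 then 1 else 0;
     0, 0, 0, 0, if i = 1 then 1 else 0;
     0, 0, 0, 0, if i = 2 then 1 else 0;
     0, 0, 0, 0, 0]

lemma repM_mul {𝕜 : Type*} [Field 𝕜] (f : Fin 3 → Fin 3 → 𝕜) (i j : Fin 3) :
    repM f i * repM f j = f i j • Matrix.single 0 4 1 := by
  ext a b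
  fin_cases a <;> fin_cases b <;> fin_cases j <;>
    simp [repM, Matrix.mul_apply, Fin.sum_univ_succ, Matrix.single]

lemma functional {𝕜 : Type*} [Field 𝕜] (ξ : 𝕜) (f : Fin 3 → Fin 3 → 𝕜)
    (h1 : f 0 0 = 0) (h2 : f 1 2 = 0) (h3 : f 2 1 = 0)
    (h4 : ξ ^ 2 * f 0 2 + f 2 0 + ξ * f 1 1 = 0)
    (h5 : ξ ^ 2 * f 0 1 + ξ * f 1 0 + f 2 2 = 0) (a b c : 𝕜)
    (hx : (a • RingQuot.mkAlgHom 𝕜 (BRel 𝕜 ξ) (FreeAlgebra.ι 𝕜 0)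
        + b • RingQuot.mkAlgHom 𝕜 (BRel 𝕜 ξ) (FreeAlgebra.ι 𝕜 1)
        + c • RingQuot.mkAlgHom 𝕜 (BRel 𝕜 ξ) (FreeAlgebra.ι 𝕜 2)) ^ 2 = 0) :
    a * b * (f 0 1 + f 1 0) + a * c * (f 0 2 + f 2 0) + b ^ 2 * f 1 1 + c ^ 2 * f 2 2 = 0 := by
  have hr : ∀ ⦃x y⦄, BRel 𝕜 ξ x y →
      FreeAlgebra.lift 𝕜 (repM f) x = FreeAlgebra.lift 𝕜 (repM f) y := by
    intro x y h
    cases h <;> simp only [map_add, map_mul, map_smul, map_zero, FreeAlgebra.lift_ι_apply,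
      repM_mul, smul_smul, ← add_smul, h1, h2, h3, h4, h5, zero_smul]
  have h := congrArg (RingQuot.liftAlgHom 𝕜 ⟨FreeAlgebra.lift 𝕜 (repM f), hr⟩) hx
  simp only [pow_two, map_add, map_mul, map_smul, map_zero, RingQuot.liftAlgHom_mkAlgHom_apply,
    FreeAlgebra.lift_ι_apply, add_mul, mul_add, smul_mul_assoc, mul_smul_comm,
    repM_mul, smul_smul, ← add_smul] at h
  have h' := congrFun (congrFun h 0) 4
  simp [h1, h2, h3] at h'
  linear_combination h'

theorem stmt15 {𝕜 : Type*} [Field 𝕜] (hchar : (6 : 𝕜) ≠ 0)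
    (ξ : 𝕜) (hξ : IsPrimitiveRoot ξ 3)
    (lam₀ lam₁ lam₂ : 𝕜)
    (hx : (lam₀ • RingQuot.mkAlgHom 𝕜 (BRel 𝕜 ξ) (FreeAlgebra.ι 𝕜 0)
        + lam₁ • RingQuot.mkAlgHom 𝕜 (BRel 𝕜 ξ) (FreeAlgebra.ι 𝕜 1)
        + lam₂ • RingQuot.mkAlgHom 𝕜 (BRel 𝕜 ξ) (FreeAlgebra.ι 𝕜 2)) ^ 2 = 0) :
    lam₁ = 0 ∧ lam₂ = 0 := by
  have h3 : ξ ^ 3 = 1 := hξ.pow_eq_one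
  have h0 : ξ ≠ 0 := hξ.ne_zero (by norm_num)
  have h1 : ξ ≠ 1 := hξ.ne_one (by norm_num)
  have hd : ξ - ξ ^ 2 ≠ 0 := by
    intro h
    have : ξ * (1 - ξ) = 0 := by linear_combination h
    rcases mul_eq_zero.1 this with h | h
    · exact h0 h
    · exact h1 (by linear_combination -h)
  have e1 := functional ξ ![![0, 1, 0], ![-1, 0, 0], ![0, 0, ξ - ξ ^ 2]]
    (by simp) (by simp) (by simp) (by simp) (by simp; ring) _ _ _ hx
  have e2 := functional ξ ![![0, 0, 1], ![0, ξ ^ 2 - ξ, 0], ![-1, 0, 0]]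
    (by simp) (by simp) (by simp) (by simp; linear_combination h3) (by simp) _ _ _ hx
  simp at e1 e2
  have hd' : ξ ^ 2 - ξ ≠ 0 := fun h => hd (by linear_combination -h)
  exact ⟨by simpa [hd'] using e2, by simpa [hd] using e1⟩
end

section
/- Let 𝕜 be a field containing a primitive 3rd root of unity ξ, and let i ∈ ℤ_3. Let V be the free 𝕜-module with basis x_0, x_1, x_2 (indices in ℤ_3) and let d_i : V ⊗ V → V ⊗ V be the linear map with d_i(x_ℓ ⊗ x_r) = −ξ^{−2i(ℓ−r)} x_{2ℓ−r} ⊗ x_ℓ for all ℓ, r ∈ ℤ_3. Then setting y_k := ξ^{−ik} x_k, one has d_i(y_ℓ ⊗ y_r) = −y_{2ℓ−r} ⊗ y_ℓ for all ℓ, r ∈ ℤ_3; in particular the linear bijection x_k ↦ y_k gives an isomorphism of braided vector spaces (V, d_0) ≅ (V, d_i). -/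
open TensorProduct

theorem stmt16 {𝕜 : Type*} [Field 𝕜] (ξ : 𝕜) (hξ : IsPrimitiveRoot ξ 3) (i : ZMod 3)
    (dᵢ : (ZMod 3 →₀ 𝕜) ⊗[𝕜] (ZMod 3 →₀ 𝕜) →ₗ[𝕜] (ZMod 3 →₀ 𝕜) ⊗[𝕜] (ZMod 3 →₀ 𝕜))
    (hdᵢ : ∀ ℓ r : ZMod 3,
      dᵢ (Finsupp.single ℓ (1 : 𝕜) ⊗ₜ[𝕜] Finsupp.single r (1 : 𝕜))
        = -(ξ ^ (-(2 * i * (ℓ - r))).val) •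
            (Finsupp.single (2 * ℓ - r) (1 : 𝕜) ⊗ₜ[𝕜] Finsupp.single ℓ (1 : 𝕜)))
    (d₀ : (ZMod 3 →₀ 𝕜) ⊗[𝕜] (ZMod 3 →₀ 𝕜) →ₗ[𝕜] (ZMod 3 →₀ 𝕜) ⊗[𝕜] (ZMod 3 →₀ 𝕜))
    (hd₀ : ∀ ℓ r : ZMod 3,
      d₀ (Finsupp.single ℓ (1 : 𝕜) ⊗ₜ[𝕜] Finsupp.single r (1 : 𝕜))
        = -(Finsupp.single (2 * ℓ - r) (1 : 𝕜) ⊗ₜ[𝕜] Finsupp.single ℓ (1 : 𝕜)))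
    (y : ZMod 3 → (ZMod 3 →₀ 𝕜))
    (hy : ∀ k : ZMod 3, y k = ξ ^ (-(i * k)).val • Finsupp.single k (1 : 𝕜))
    (φ : (ZMod 3 →₀ 𝕜) →ₗ[𝕜] (ZMod 3 →₀ 𝕜))
    (hφ : ∀ k : ZMod 3, φ (Finsupp.single k (1 : 𝕜)) = y k) :
    -- in the basis `y_k = ξ^{−ik} x_k` the braiding becomes constant:
    (∀ ℓ r : ZMod 3, dᵢ (y ℓ ⊗ₜ[𝕜] y r) = -(y (2 * ℓ - r) ⊗ₜ[𝕜] y ℓ)) ∧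
    -- `x_k ↦ y_k` is an isomorphism of braided vector spaces `(V, d₀) ≅ (V, dᵢ)`
    Function.Bijective φ ∧
    TensorProduct.map φ φ ∘ₗ d₀ = dᵢ ∘ₗ TensorProduct.map φ φ := by
  have h3 : ξ ^ 3 = 1 := hξ.pow_eq_one
  have h0 : ξ ≠ 0 := hξ.ne_zero (by norm_num)
  have hadd : ∀ a b : ZMod 3, ξ ^ a.val * ξ ^ b.val = ξ ^ (a + b).val := by
    intro a b
    rw [← pow_add, ZMod.val_add]
    exact pow_eq_pow_mod _ h3
  have h1 : ∀ ℓ r : ZMod 3, dᵢ (y ℓ ⊗ₜ[𝕜] y r) = -(y (2 * ℓ - r) ⊗ₜ[𝕜] y ℓ) := by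
    intro ℓ r
    simp only [hy, TensorProduct.smul_tmul_smul, map_smul, hdᵢ, smul_smul, hadd, mul_neg]
    have e : -(i * ℓ) + -(i * r) + -(2 * i * (ℓ - r)) = -(i * (2 * ℓ - r)) + -(i * ℓ) := by
      ring
    rw [e]
    exact neg_smul (M := (ZMod 3 →₀ 𝕜) ⊗[𝕜] (ZMod 3 →₀ 𝕜)) _ _
  refine ⟨h1, ?_, ?_⟩
  · have hs : Function.Surjective φ := by
      rw [← LinearMap.range_eq_top, eq_top_iff]
      rintro v -
      induction v using Finsupp.induction_linear with
      | zero => exact zero_mem _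
      | add f g hf hg => exact add_mem hf hg
      | single k c =>
        refine ⟨(c * (ξ ^ (-(i * k)).val)⁻¹) • Finsupp.single k 1, ?_⟩
        rw [map_smul, hφ, hy, smul_smul, mul_assoc, inv_mul_cancel₀ (pow_ne_zero _ h0)]
        simp
    exact ⟨LinearMap.injective_iff_surjective.mpr hs, hs⟩
  · ext ℓ r : 5
    simp [-Finsupp.smul_single, hd₀, hφ, h1]
    have hn : ∀ x : (ZMod 3 →₀ 𝕜) ⊗[𝕜] (ZMod 3 →₀ 𝕜), -x = (-1 : 𝕜) • x := fun x =>
      (neg_one_smul (M := (ZMod 3 →₀ 𝕜) ⊗[𝕜] (ZMod 3 →₀ 𝕜)) 𝕜 x).symm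
    rw [hn, hn, map_smul, TensorProduct.map_tmul, hφ, hφ]
end

section
/- Let 𝕜 be a field containing a primitive 3rd root of unity ξ, and let i ∈ ℤ_3. Let W be the free 𝕜-module with basis w_0, w_1, w_2 (indices in ℤ_3) and let c : W ⊗ W → W ⊗ W be the linear map with c(w_ℓ ⊗ w_r) = −ξ^{−2i(ℓ+r)} w_{−r} ⊗ w_{ℓ+2r} for all ℓ, r ∈ ℤ_3 (the braiding c^−_{i,i} of W^−_{i,i}). Then, setting x_k := w_0 + ξ^k w_1 + ξ^{2k} w_2 for k ∈ ℤ_3, one has c(x_ℓ ⊗ x_r) = −x_{2ℓ−r+i} ⊗ x_{ℓ+i} for all ℓ, r ∈ ℤ_3. -/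
open TensorProduct

theorem stmt17 {𝕜 : Type*} [Field 𝕜] (ξ : 𝕜) (hξ : IsPrimitiveRoot ξ 3) (i : ZMod 3)
    (c : (ZMod 3 →₀ 𝕜) ⊗[𝕜] (ZMod 3 →₀ 𝕜) →ₗ[𝕜] (ZMod 3 →₀ 𝕜) ⊗[𝕜] (ZMod 3 →₀ 𝕜))
    (hc : ∀ ℓ r : ZMod 3,
      c (Finsupp.single ℓ (1 : 𝕜) ⊗ₜ[𝕜] Finsupp.single r (1 : 𝕜))
        = -(ξ ^ (-(2 * i * (ℓ + r))).val) •
            (Finsupp.single (-r) (1 : 𝕜) ⊗ₜ[𝕜] Finsupp.single (ℓ + 2 * r) (1 : 𝕜)))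
    (x : ZMod 3 → (ZMod 3 →₀ 𝕜))
    (hx : ∀ k : ZMod 3,
      x k = Finsupp.single 0 (1 : 𝕜) + Finsupp.single 1 (ξ ^ k.val)
          + Finsupp.single 2 (ξ ^ (2 * k).val)) :
    ∀ ℓ r : ZMod 3, c (x ℓ ⊗ₜ[𝕜] x r) = -(x (2 * ℓ - r + i) ⊗ₜ[𝕜] x (ℓ + i)) := by
  have e_add : ∀ a b : ZMod 3, ξ ^ (a + b).val = ξ ^ a.val * ξ ^ b.val := by
    intro a b
    rw [ZMod.val_add, ← pow_add]
    exact (pow_eq_pow_mod _ hξ.pow_eq_one).symm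
  have hx' : ∀ k : ZMod 3, x k = ∑ a : ZMod 3, ξ ^ (k * a).val • Finsupp.single a (1 : 𝕜) := by
    intro k
    have h : ∀ f : ZMod 3 → (ZMod 3 →₀ 𝕜), ∑ a, f a = f 0 + f 1 + f 2 :=
      fun f => Fin.sum_univ_three f
    rw [h, hx]
    simp [mul_comm]
  have hxx : ∀ k m : ZMod 3, x k ⊗ₜ[𝕜] x m = ∑ p : ZMod 3 × ZMod 3,
      ξ ^ (k * p.1 + m * p.2).val •
        (Finsupp.single p.1 (1 : 𝕜) ⊗ₜ[𝕜] Finsupp.single p.2 (1 : 𝕜)) := by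
    intro k m
    rw [hx', hx', TensorProduct.sum_tmul, Fintype.sum_prod_type]
    refine Finset.sum_congr rfl fun a _ => ?_
    rw [TensorProduct.tmul_sum]
    refine Finset.sum_congr rfl fun b _ => ?_
    rw [TensorProduct.smul_tmul_smul, e_add]
  intro ℓ r
  let σ : ZMod 3 × ZMod 3 ≃ ZMod 3 × ZMod 3 :=
    { toFun := fun p => (-p.2, p.1 + 2 * p.2)
      invFun := fun p => (p.2 + 2 * p.1, -p.1)
      left_inv := by decide
      right_inv := by decide }
  rw [hxx, hxx, map_sum]
  refine Eq.trans ?_ (Finset.sum_neg_distrib (G := (ZMod 3 →₀ 𝕜) ⊗[𝕜] (ZMod 3 →₀ 𝕜)) _)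
  refine Fintype.sum_equiv σ _ _ ?_
  rintro ⟨a, b⟩
  have key : ∀ ℓ r i a b : ZMod 3, (2 * ℓ - r + i) * (-b) + (ℓ + i) * (a + 2 * b)
      = (ℓ * a + r * b) + -(2 * i * (a + b)) := by decide
  change c _ = -(ξ ^ ((2 * ℓ - r + i) * (-b) + (ℓ + i) * (a + 2 * b)).val •
    (Finsupp.single (-b) (1 : 𝕜) ⊗ₜ[𝕜] Finsupp.single (a + 2 * b) (1 : 𝕜)))
  rw [key, e_add (ℓ * a + r * b), map_smul, hc, smul_smul, mul_neg]
  exact neg_smul (M := (ZMod 3 →₀ 𝕜) ⊗[𝕜] (ZMod 3 →₀ 𝕜)) _ _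
end

section
/- Let 𝕜 be a field containing a primitive 3rd root of unity ξ. Let V be the free 𝕜-module with basis x_0, x_1, x_2 (indices in ℤ_3), and for i ∈ ℤ_3 let c_i : V ⊗ V → V ⊗ V be the linear map with c_i(x_ℓ ⊗ x_r) = −x_{2ℓ−r+i} ⊗ x_{ℓ+i} for all ℓ, r ∈ ℤ_3. Then the linear bijection φ : V → V determined by φ(x_k) = x_{−k} satisfies (φ ⊗ φ) ∘ c_1 = c_2 ∘ (φ ⊗ φ); that is, φ is an isomorphism of braided vector spaces from (V, c_1) to (V, c_2). -/
open TensorProduct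

theorem stmt18 {𝕜 : Type*} [Field 𝕜] (ξ : 𝕜) (hξ : IsPrimitiveRoot ξ 3)
    (c₁ c₂ : (ZMod 3 →₀ 𝕜) ⊗[𝕜] (ZMod 3 →₀ 𝕜) →ₗ[𝕜] (ZMod 3 →₀ 𝕜) ⊗[𝕜] (ZMod 3 →₀ 𝕜))
    (hc₁ : ∀ ℓ r : ZMod 3,
      c₁ (Finsupp.single ℓ (1 : 𝕜) ⊗ₜ[𝕜] Finsupp.single r (1 : 𝕜))
        = -(Finsupp.single (2 * ℓ - r + 1) (1 : 𝕜) ⊗ₜ[𝕜] Finsupp.single (ℓ + 1) (1 : 𝕜)))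
    (hc₂ : ∀ ℓ r : ZMod 3,
      c₂ (Finsupp.single ℓ (1 : 𝕜) ⊗ₜ[𝕜] Finsupp.single r (1 : 𝕜))
        = -(Finsupp.single (2 * ℓ - r + 2) (1 : 𝕜) ⊗ₜ[𝕜] Finsupp.single (ℓ + 2) (1 : 𝕜)))
    (φ : (ZMod 3 →₀ 𝕜) →ₗ[𝕜] (ZMod 3 →₀ 𝕜))
    (hφ : ∀ k : ZMod 3, φ (Finsupp.single k (1 : 𝕜)) = Finsupp.single (-k) (1 : 𝕜)) :
    Function.Bijective φ ∧
    TensorProduct.map φ φ ∘ₗ c₁ = c₂ ∘ₗ TensorProduct.map φ φ := by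
  have hinv : φ ∘ₗ φ = LinearMap.id := by
    refine Finsupp.lhom_ext' fun k => LinearMap.ext_ring ?_
    simp [hφ]
  refine ⟨Function.Involutive.bijective fun v => LinearMap.congr_fun hinv v, ?_⟩
  refine TensorProduct.ext ?_
  refine Finsupp.lhom_ext' fun l => LinearMap.ext_ring ?_
  refine Finsupp.lhom_ext' fun r => LinearMap.ext_ring ?_
  have h1 : -(2 * l - r + 1) = 2 * (-l) - (-r) + 2 := by revert l r; decide
  have h2 : -(l + 1) = -l + 2 := by clear h1; revert l; decide
  simp only [LinearMap.compr₂ₛₗ_apply, LinearMap.comp_apply, TensorProduct.mk_apply,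
    Finsupp.lsingle_apply, hc₁, hc₂, TensorProduct.map_tmul, hφ]
  have hn : ∀ x : (ZMod 3 →₀ 𝕜) ⊗[𝕜] (ZMod 3 →₀ 𝕜),
      TensorProduct.map φ φ (-x) = - TensorProduct.map φ φ x := fun x =>
    _root_.map_neg (TensorProduct.map φ φ).toAddMonoidHom x
  rw [hn, TensorProduct.map_tmul, hφ, hφ, h1, h2]
end

section
/- Let 𝕜 be a field of characteristic zero or coprime to 6 containing a primitive 3rd root of unity ξ. Let 𝔅_ξ be the quotient of the free 𝕜-algebra on w_0, w_1, w_2 by the ideal generated by w_0², w_1w_2, w_2w_1, ξ²w_0w_2 + w_2w_0 + ξw_1², ξ²w_0w_1 + ξw_1w_0 + w_2², and let B be the quotient of the free 𝕜-algebra on x_0, x_1, x_2 by the ideal generated by x_0x_1, x_1x_2, x_2x_0, x_0x_2 + x_2x_1 + x_1x_0, and x_0² + x_1² + x_2². Then the algebra map determined by x_k ↦ w_0 + ξ^k w_1 + ξ^{2k} w_2 (k = 0, 1, 2) is a 𝕜-algebra isomorphism from B onto 𝔅_ξ. -/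
/-- Relations presenting the algebra `B`: `x₀x₁`, `x₁x₂`, `x₂x₀`,
`x₀x₂ + x₂x₁ + x₁x₀`, `x₀² + x₁² + x₂²`. -/
inductive CRel (𝕜 : Type*) [Field 𝕜] :
    FreeAlgebra 𝕜 (Fin 3) → FreeAlgebra 𝕜 (Fin 3) → Prop
  | r1 : CRel 𝕜 (FreeAlgebra.ι 𝕜 0 * FreeAlgebra.ι 𝕜 1) 0
  | r2 : CRel 𝕜 (FreeAlgebra.ι 𝕜 1 * FreeAlgebra.ι 𝕜 2) 0
  | r3 : CRel 𝕜 (FreeAlgebra.ι 𝕜 2 * FreeAlgebra.ι 𝕜 0) 0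
  | r4 : CRel 𝕜 (FreeAlgebra.ι 𝕜 0 * FreeAlgebra.ι 𝕜 2 + FreeAlgebra.ι 𝕜 2 * FreeAlgebra.ι 𝕜 1
      + FreeAlgebra.ι 𝕜 1 * FreeAlgebra.ι 𝕜 0) 0
  | r5 : CRel 𝕜 (FreeAlgebra.ι 𝕜 0 * FreeAlgebra.ι 𝕜 0 + FreeAlgebra.ι 𝕜 1 * FreeAlgebra.ι 𝕜 1
      + FreeAlgebra.ι 𝕜 2 * FreeAlgebra.ι 𝕜 2) 0

theorem fwd19 {𝕜 A : Type*} [Field 𝕜] [Ring A] [Algebra 𝕜 A] (q : 𝕜) (hq : q ^ 2 + q + 1 = 0)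
    (a b d : A) (h1 : a * a = 0) (h2 : b * d = 0) (h3 : d * b = 0)
    (h4 : q ^ 2 • (a * d) + d * a + q • (b * b) = 0)
    (h5 : q ^ 2 • (a * b) + q • (b * a) + d * d = 0) (x : Fin 3 → A)
    (hx : ∀ k : Fin 3, x k = a + q ^ (k : ℕ) • b + q ^ (2 * (k : ℕ)) • d) :
    x 0 * x 1 = 0 ∧ x 1 * x 2 = 0 ∧ x 2 * x 0 = 0 ∧ x 0 * x 2 + x 2 * x 1 + x 1 * x 0 = 0 ∧
      x 0 * x 0 + x 1 * x 1 + x 2 * x 2 = 0 := by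
  have x0 : x 0 = a + b + d := by simp [hx]
  have x1 : x 1 = a + q • b + q ^ 2 • d := by simp [hx]
  have x2 : x 2 = a + q ^ 2 • b + q • d := by
    rw [hx]
    simp only [Fin.val_two]
    match_scalars <;> grind
  rw [x0, x1, x2]
  refine ⟨?_, ?_, ?_, ?_, ?_⟩
  · trans (1 : 𝕜) • (a * a) + q ^ 2 • (b * d) + q • (d * b)
      + (1 : 𝕜) • (q ^ 2 • (a * d) + d * a + q • (b * b))
      + q ^ 2 • (q ^ 2 • (a * b) + q • (b * a) + d * d)
    · simp only [add_mul, mul_add, smul_mul_assoc, mul_smul_comm]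
      match_scalars <;> grind
    · simp [h1, h2, h3, h4, h5]
  · trans (1 : 𝕜) • (a * a) + q ^ 2 • (b * d) + q • (d * b)
      + q ^ 2 • (q ^ 2 • (a * d) + d * a + q • (b * b))
      + (1 : 𝕜) • (q ^ 2 • (a * b) + q • (b * a) + d * d)
    · simp only [add_mul, mul_add, smul_mul_assoc, mul_smul_comm]
      match_scalars <;> grind
    · simp [h1, h2, h3, h4, h5]
  · trans (1 : 𝕜) • (a * a) + q ^ 2 • (b * d) + q • (d * b)
      + q • (q ^ 2 • (a * d) + d * a + q • (b * b))
      + q • (q ^ 2 • (a * b) + q • (b * a) + d * d)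
    · simp only [add_mul, mul_add, smul_mul_assoc, mul_smul_comm]
      match_scalars <;> grind
    · simp [h1, h2, h3, h4, h5]
  · trans (3 : 𝕜) • ((a * a) + q • (b * d) + q ^ 2 • (d * b))
    · simp only [add_mul, mul_add, smul_mul_assoc, mul_smul_comm]
      match_scalars <;> grind
    · simp [h1, h2, h3]
  · trans (3 : 𝕜) • ((a * a) + (b * d) + (d * b))
    · simp only [add_mul, mul_add, smul_mul_assoc, mul_smul_comm]
      match_scalars <;> grind
    · simp [h1, h2, h3]

theorem bwd19 {𝕜 A : Type*} [Field 𝕜] [Ring A] [Algebra 𝕜 A] (q : 𝕜) (hq : q ^ 2 + q + 1 = 0)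
    (c : 𝕜) (hc : 3 * c = 1)
    (x y z : A) (h1 : x * y = 0) (h2 : y * z = 0) (h3 : z * x = 0)
    (h4 : x * z + z * y + y * x = 0) (h5 : x * x + y * y + z * z = 0) (a b d : A)
    (ha : a = c • (x + y + z)) (hb : b = c • (x + q ^ 2 • y + q • z))
    (hd : d = c • (x + q • y + q ^ 2 • z)) :
    a * a = 0 ∧ b * d = 0 ∧ d * b = 0 ∧ q ^ 2 • (a * d) + d * a + q • (b * b) = 0 ∧
      q ^ 2 • (a * b) + q • (b * a) + d * d = 0 := by
  subst ha hb hd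
  refine ⟨?_, ?_, ?_, ?_, ?_⟩
  · trans (c ^ 2) • (x * y + y * z + z * x + (x * z + z * y + y * x) + (x * x + y * y + z * z))
    · simp only [add_mul, mul_add, smul_mul_assoc, mul_smul_comm]
      match_scalars <;> grind
    · simp [h1, h2, h3, h4, h5]
  · trans (c ^ 2) • (q • (x * y + y * z + z * x) + q ^ 2 • (x * z + z * y + y * x)
      + (x * x + y * y + z * z))
    · simp only [add_mul, mul_add, smul_mul_assoc, mul_smul_comm]
      match_scalars <;> grind
    · simp [h1, h2, h3, h4, h5]
  · trans (c ^ 2) • (q ^ 2 • (x * y + y * z + z * x) + q • (x * z + z * y + y * x)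
      + (x * x + y * y + z * z))
    · simp only [add_mul, mul_add, smul_mul_assoc, mul_smul_comm]
      match_scalars <;> grind
    · simp [h1, h2, h3, h4, h5]
  · trans c • (x * y + q • (y * z) + q ^ 2 • (z * x))
    · simp only [add_mul, mul_add, smul_mul_assoc, mul_smul_comm]
      match_scalars <;> grind
    · simp [h1, h2, h3]
  · trans c • (q • (x * y) + (y * z) + q ^ 2 • (z * x))
    · simp only [add_mul, mul_add, smul_mul_assoc, mul_smul_comm]
      match_scalars <;> grind
    · simp [h1, h2, h3]

set_option maxHeartbeats 2000000 in
theorem stmt19 {𝕜 : Type*} [Field 𝕜] (hchar : (6 : 𝕜) ≠ 0)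
    (ξ : 𝕜) (hξ : IsPrimitiveRoot ξ 3) :
    ∃ ψ : RingQuot (CRel 𝕜) →ₐ[𝕜] RingQuot (BRel 𝕜 ξ),
      (∀ k : Fin 3,
        ψ (RingQuot.mkAlgHom 𝕜 (CRel 𝕜) (FreeAlgebra.ι 𝕜 k))
          = RingQuot.mkAlgHom 𝕜 (BRel 𝕜 ξ)
              (FreeAlgebra.ι 𝕜 0 + ξ ^ (k : ℕ) • FreeAlgebra.ι 𝕜 1
                + ξ ^ (2 * (k : ℕ)) • FreeAlgebra.ι 𝕜 2)) ∧
      Function.Bijective ψ := by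
  have hq : ξ ^ 2 + ξ + 1 = 0 := by
    have h3 : ξ ^ 3 = 1 := hξ.pow_eq_one
    have h1 : ξ - 1 ≠ 0 := sub_ne_zero.mpr (hξ.ne_one (by norm_num))
    apply mul_left_cancel₀ h1
    linear_combination h3
  have h30 : (3 : 𝕜) ≠ 0 := by
    intro h
    apply hchar
    linear_combination 2 * h
  obtain ⟨c, hc⟩ : ∃ c : 𝕜, 3 * c = 1 := ⟨3⁻¹, mul_inv_cancel₀ h30⟩
  let w : Fin 3 → RingQuot (BRel 𝕜 ξ) :=
    fun k => RingQuot.mkAlgHom 𝕜 (BRel 𝕜 ξ) (FreeAlgebra.ι 𝕜 k)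
  let x : Fin 3 → RingQuot (CRel 𝕜) :=
    fun k => RingQuot.mkAlgHom 𝕜 (CRel 𝕜) (FreeAlgebra.ι 𝕜 k)
  let X : Fin 3 → RingQuot (BRel 𝕜 ξ) :=
    fun k => w 0 + ξ ^ (k : ℕ) • w 1 + ξ ^ (2 * (k : ℕ)) • w 2
  let W : Fin 3 → RingQuot (CRel 𝕜) :=
    ![c • (x 0 + x 1 + x 2), c • (x 0 + ξ ^ 2 • x 1 + ξ • x 2),
      c • (x 0 + ξ • x 1 + ξ ^ 2 • x 2)]
  have hB : ∀ {u v}, BRel 𝕜 ξ u v →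
      RingQuot.mkAlgHom 𝕜 (BRel 𝕜 ξ) u = RingQuot.mkAlgHom 𝕜 (BRel 𝕜 ξ) v :=
    fun h => RingQuot.mkAlgHom_rel 𝕜 h
  have hC : ∀ {u v}, CRel 𝕜 u v →
      RingQuot.mkAlgHom 𝕜 (CRel 𝕜) u = RingQuot.mkAlgHom 𝕜 (CRel 𝕜) v :=
    fun h => RingQuot.mkAlgHom_rel 𝕜 h
  obtain ⟨f1, f2, f3, f4, f5⟩ := fwd19 ξ hq (w 0) (w 1) (w 2)
    (by simpa using hB .r1) (by simpa using hB .r2) (by simpa using hB .r3)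
    (by simpa using hB .r4) (by simpa using hB .r5) X (fun _ => rfl)
  obtain ⟨g1, g2, g3, g4, g5⟩ := bwd19 ξ hq c hc (x 0) (x 1) (x 2)
    (by simpa using hC .r1) (by simpa using hC .r2) (by simpa using hC .r3)
    (by simpa using hC .r4) (by simpa using hC .r5) (W 0) (W 1) (W 2) rfl rfl rfl
  let ψ : RingQuot (CRel 𝕜) →ₐ[𝕜] RingQuot (BRel 𝕜 ξ) :=
    RingQuot.liftAlgHom 𝕜 ⟨FreeAlgebra.lift 𝕜 X, by
      intro u v h
      cases h <;> simpa using by assumption⟩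
  let φ : RingQuot (BRel 𝕜 ξ) →ₐ[𝕜] RingQuot (CRel 𝕜) :=
    RingQuot.liftAlgHom 𝕜 ⟨FreeAlgebra.lift 𝕜 W, by
      intro u v h
      cases h <;> simp only [map_mul, map_add, map_smul, map_zero, FreeAlgebra.lift_ι_apply] <;>
        assumption⟩
  have hψ : ∀ k, ψ (x k) = X k := fun k => by
    simp only [ψ, x, RingQuot.liftAlgHom_mkAlgHom_apply, FreeAlgebra.lift_ι_apply]
  have hφ : ∀ k, φ (w k) = W k := fun k => by
    simp only [φ, w, RingQuot.liftAlgHom_mkAlgHom_apply, FreeAlgebra.lift_ι_apply]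
  have W0 : W 0 = c • (x 0 + x 1 + x 2) := rfl
  have W1 : W 1 = c • (x 0 + ξ ^ 2 • x 1 + ξ • x 2) := rfl
  have W2 : W 2 = c • (x 0 + ξ • x 1 + ξ ^ 2 • x 2) := rfl
  have X0 : X 0 = w 0 + ξ ^ 0 • w 1 + ξ ^ 0 • w 2 := rfl
  have X1 : X 1 = w 0 + ξ ^ 1 • w 1 + ξ ^ 2 • w 2 := rfl
  have X2 : X 2 = w 0 + ξ ^ 2 • w 1 + ξ ^ 4 • w 2 := rfl
  have hφψ : φ.comp ψ = AlgHom.id 𝕜 _ := by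
    apply RingQuot.ringQuot_ext'
    apply FreeAlgebra.hom_ext
    funext k
    change φ (ψ (x k)) = x k
    rw [hψ]
    fin_cases k
    · change φ (X 0) = x 0
      simp only [X0, map_add, map_smul, hφ, W0, W1, W2]
      match_scalars <;> grind
    · change φ (X 1) = x 1
      simp only [X1, map_add, map_smul, hφ, W0, W1, W2]
      match_scalars <;> grind
    · change φ (X 2) = x 2
      simp only [X2, map_add, map_smul, hφ, W0, W1, W2]
      match_scalars <;> grind
  have hψφ : ψ.comp φ = AlgHom.id 𝕜 _ := by
    apply RingQuot.ringQuot_ext'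
    apply FreeAlgebra.hom_ext
    funext k
    change ψ (φ (w k)) = w k
    rw [hφ]
    fin_cases k
    · change ψ (W 0) = w 0
      simp only [W0, map_add, map_smul, hψ, X0, X1, X2]
      match_scalars <;> grind
    · change ψ (W 1) = w 1
      simp only [W1, map_add, map_smul, hψ, X0, X1, X2]
      match_scalars <;> grind
    · change ψ (W 2) = w 2
      simp only [W2, map_add, map_smul, hψ, X0, X1, X2]
      match_scalars <;> grind
  refine ⟨ψ, fun k => ?_, ?_⟩
  · simp only [map_add, map_smul]
    exact hψ k
  · exact Function.bijective_iff_has_inverse.mpr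
      ⟨φ, fun u => DFunLike.congr_fun hφψ u, fun u => DFunLike.congr_fun hψφ u⟩
end
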